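/- Let m ≥ 1, n_i ≥ 1, 1 < p < q < ∞, 0 ≤ β_i < n_i, γ_i < n_i(p-1), and β_i + (α_i+n_i)/q = (γ_i+n_i)/p for 1 ≤ i ≤ m. Then for f ∈ L^p(ℝ^{n₁}×⋯×ℝ^{n_m}, |x|^γ), ‖𝓗_{β₁,…,β_m}(f)‖_{L^q(|x|^α)} ≤ C* ‖f‖_{L^p(|x|^γ)}, where C* = ∏_{i=1}^m |S^{n_i-1}|^{1/q-1/p+β_i/n_i} n_i^{1/p-1/q-β_i/n_i} (n_i(p-1)/(n_i(p-1)-γ_i))^{1/p'+1/q} (p'/q)^{1/q} ((p/(q-p)) B(p/(q-p), pq/(q'(q-p))))^{1/q-1/p}, and C* is exactly the operator norm of 𝓗_{β₁,…,β_m} from L^p(|x|^γ) to L^q(|x|^α). -/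

import Mathlib

open MeasureTheory Set
open scoped ENNReal

/-- The Euler Beta function `B(z,w) = ∫₀¹ t^(z-1) (1-t)^(w-1) dt`. -/
noncomputable def betaFn (z w : ℝ) : ℝ :=
  ∫ t in Ioo (0 : ℝ) 1, t ^ (z - 1) * (1 - t) ^ (w - 1)

/-- Surface area `|S^{n-1}| = 2 π^{n/2} / Γ(n/2)` of the unit sphere. -/
noncomputable def omegaN (n : ℕ) : ℝ :=
  2 * Real.pi ^ ((n : ℝ) / 2) / Real.Gamma ((n : ℝ) / 2)

/-- The fractional Hardy operator `𝓗_{β₁,…,β_m}` on `ℝ^{n₁} × ⋯ × ℝ^{n_m}`. -/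
noncomputable def prodFracHardy (m : ℕ) (n : Fin m → ℕ) (β : Fin m → ℝ)
    (f : (∀ i, EuclideanSpace ℝ (Fin (n i))) → ℝ≥0∞)
    (x : ∀ i, EuclideanSpace ℝ (Fin (n i))) : ℝ≥0∞ :=
  (∏ i, (volume (Metric.ball (0 : EuclideanSpace ℝ (Fin (n i))) ‖x i‖)) ^
      (β i / (n i : ℝ) - 1)) *
    ∫⁻ y in {y : ∀ i, EuclideanSpace ℝ (Fin (n i)) | ∀ i, ‖y i‖ < ‖x i‖}, f y


/-- **Minkowski's integral inequality** for `ℝ≥0∞`-valued functions. -/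
theorem lintegral_lintegral_rpow_le {α β : Type*} [MeasurableSpace α] [MeasurableSpace β]
    {μ : Measure α} [SigmaFinite μ] {ν : Measure β} [SFinite ν] {r : ℝ} (hr : 1 < r)
    {F : α → β → ℝ≥0∞} (hF : Measurable (Function.uncurry F)) :
    (∫⁻ x, (∫⁻ y, F x y ∂ν) ^ r ∂μ) ^ (1 / r) ≤ ∫⁻ y, (∫⁻ x, F x y ^ r ∂μ) ^ (1 / r) ∂ν := by
  have hr0 : 0 < r := by linarith
  set Φ : α → ℝ≥0∞ := fun x ↦ ∫⁻ y, F x y ∂ν with hΦ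
  have hΦm : Measurable Φ := hF.lintegral_prod_right'
  set R := ∫⁻ y, (∫⁻ x, F x y ^ r ∂μ) ^ (1 / r) ∂ν with hR
  set ψ : ℕ → α → ℝ≥0∞ := fun k ↦ (spanningSets μ k).indicator fun x ↦ min (Φ x) k with hψ
  have hψm : ∀ k, Measurable (ψ k) := fun k ↦
    (hΦm.min measurable_const).indicator (measurableSet_spanningSets μ k)
  have hψle : ∀ k x, ψ k x ≤ Φ x := fun k x ↦
    (indicator_le_self _ _ x).trans (min_le_left _ _)
  have hψfin : ∀ k, ∫⁻ x, ψ k x ^ r ∂μ ≠ ∞ := fun k ↦ by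
    have : ∀ x, ψ k x ^ r ≤ (spanningSets μ k).indicator (fun _ ↦ (k : ℝ≥0∞) ^ r) x := by
      intro x
      by_cases hx : x ∈ spanningSets μ k
      · simp only [hψ, indicator_of_mem hx]
        exact ENNReal.rpow_le_rpow (min_le_right _ _) hr0.le
      · simp [hψ, indicator_of_notMem hx, hr0]
    refine ((lintegral_mono this).trans_lt ?_).ne
    rw [lintegral_indicator_const (measurableSet_spanningSets μ k)]
    exact ENNReal.mul_lt_top (ENNReal.rpow_lt_top_of_nonneg hr0.le (ENNReal.natCast_ne_top k))
      (measure_spanningSets_lt_top μ k)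
  have hconj : r.HolderConjugate (Real.conjExponent r) := Real.HolderConjugate.conjExponent hr
  have key : ∀ k, ∫⁻ x, ψ k x ^ r ∂μ ≤ R ^ r := by
    intro k
    set I := ∫⁻ x, ψ k x ^ r ∂μ with hI
    have h1 : I ≤ R * I ^ (1 - 1 / r) := by
      calc I ≤ ∫⁻ x, Φ x * ψ k x ^ (r - 1) ∂μ := by
            refine lintegral_mono fun x ↦ ?_
            calc ψ k x ^ r = ψ k x ^ (1 + (r - 1)) := by ring_nf
              _ = ψ k x * ψ k x ^ (r - 1) := by
                rw [ENNReal.rpow_add_of_nonneg _ _ zero_le_one (by linarith), ENNReal.rpow_one]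
              _ ≤ _ := by gcongr; exact hψle k x
        _ = ∫⁻ x, ∫⁻ y, F x y * ψ k x ^ (r - 1) ∂ν ∂μ := by
            refine lintegral_congr fun x ↦ ?_
            rw [lintegral_mul_const _ hF.of_uncurry_left]
        _ = ∫⁻ y, ∫⁻ x, F x y * ψ k x ^ (r - 1) ∂μ ∂ν := by
            apply lintegral_lintegral_swap
            exact (hF.mul (((hψm k).comp measurable_fst).pow_const _)).aemeasurable
        _ ≤ ∫⁻ y, (∫⁻ x, F x y ^ r ∂μ) ^ (1 / r) * I ^ (1 - 1 / r) ∂ν := by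
            refine lintegral_mono fun y ↦ ?_
            refine (ENNReal.lintegral_mul_le_Lp_mul_Lq μ hconj
              (hF.of_uncurry_right).aemeasurable ((hψm k).pow_const _).aemeasurable).trans ?_
            have e1 : 1 / Real.conjExponent r = 1 - 1 / r := by
              have := hconj.inv_add_inv_eq_one
              simp only [one_div]; linarith
            have e2 : (r - 1) * Real.conjExponent r = r := by
              rw [Real.conjExponent]; field_simp [sub_ne_zero.2 hr.ne']
            simp only [← ENNReal.rpow_mul, e2, e1]
            rfl
        _ = R * I ^ (1 - 1 / r) := by
            rw [lintegral_mul_const]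
            exact Measurable.pow_const ((hF.pow_const r).lintegral_prod_left') _
    rcases eq_or_ne I 0 with h0 | h0
    · simp [h0]
    have hfin := hψfin k
    have h2 : I ^ (1 / r) ≤ R := by
      have h3 : I ^ (1 / r) * I ^ (1 - 1 / r) ≤ R * I ^ (1 - 1 / r) := by
        rw [← ENNReal.rpow_add _ _ h0 hfin]; simpa using h1
      have hfin' : I ≠ ∞ := hfin
      have hz : I ^ (1 - 1 / r) ≠ 0 := by simp [h0, hfin', ENNReal.rpow_eq_zero_iff]
      have ht : I ^ (1 - 1 / r) ≠ ∞ := by simp [h0, hfin', ENNReal.rpow_eq_top_iff]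
      exact (ENNReal.mul_le_mul_iff_left hz ht).1 h3
    calc I = (I ^ (1 / r)) ^ r := by
          rw [← ENNReal.rpow_mul]; simp [hr0.ne']
      _ ≤ _ := ENNReal.rpow_le_rpow h2 hr0.le
  have hmono : Monotone ψ := by
    intro i j hij x
    simp only [hψ]
    refine (indicator_le_indicator_of_subset (monotone_spanningSets μ hij) (fun _ ↦ zero_le) x).trans
      (indicator_le_indicator ?_)
    gcongr
  have hsup : ∀ x, ⨆ k, ψ k x ^ r = Φ x ^ r := by
    intro x
    refine iSup_eq_of_tendsto (fun i j hij ↦ ENNReal.rpow_le_rpow (hmono hij x) hr0.le) ?_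
    refine (ENNReal.continuous_rpow_const.tendsto _).comp ?_
    have : ∀ᶠ k : ℕ in Filter.atTop, min (Φ x) k = ψ k x := by
      filter_upwards [Filter.eventually_ge_atTop (spanningSetsIndex μ x)] with k hk
      rw [hψ]
      simp only
      rw [indicator_of_mem (mem_spanningSets_of_index_le μ x hk)]
    refine Filter.Tendsto.congr' this ?_
    simpa using (tendsto_const_nhds (x := Φ x)).min ENNReal.tendsto_nat_nhds_top
  have hfinal : ∫⁻ x, Φ x ^ r ∂μ ≤ R ^ r := by
    simp_rw [← hsup]
    rw [lintegral_iSup (fun k ↦ (hψm k).pow_const r)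
      (fun i j hij x ↦ ENNReal.rpow_le_rpow (hmono hij x) hr0.le)]
    exact iSup_le key
  calc _ ≤ (R ^ r) ^ (1 / r) := ENNReal.rpow_le_rpow hfinal (by positivity)
    _ = R := by rw [← ENNReal.rpow_mul]; simp [hr0.ne']

/-- The positive integral operator with kernel `K` maps `L^p(g)` to `L^q(a)` with norm at most
`C`. -/
def KernelBound {E : Type*} [MeasureSpace E] (K : E → E → ℝ≥0∞) (a g : E → ℝ≥0∞) (p q : ℝ)
    (C : ℝ≥0∞) : Prop :=
  ∀ f : E → ℝ≥0∞, Measurable f →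
    (∫⁻ x, (∫⁻ y, K x y * f y) ^ q * a x) ^ (1 / q) ≤ C * (∫⁻ x, f x ^ p * g x) ^ (1 / p)

/-- Fubini's theorem for the first coordinate of a finite product. -/
theorem lintegral_pi_succ {m : ℕ} {E : Fin (m + 1) → Type*} [∀ i, MeasureSpace (E i)]
    [∀ i, SigmaFinite (volume : Measure (E i))] {f : (∀ i, E i) → ℝ≥0∞} (hf : Measurable f) :
    ∫⁻ x, f x = ∫⁻ x0 : E 0, ∫⁻ x' : ∀ i : Fin m, E i.succ, f (Fin.cons x0 x') := by
  have h := (volume_preserving_piFinSuccAbove E 0).symm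
  rw [← h.lintegral_comp hf]
  have hm := hf.comp (MeasurableEquiv.piFinSuccAbove E 0).symm.measurable
  refine (lintegral_prod _ hm.aemeasurable).trans ?_
  refine lintegral_congr fun x0 ↦ lintegral_congr fun x' ↦ congrArg f ?_
  exact Fin.insertNth_zero x0 x'

theorem measurable_finCons {m : ℕ} {E : Fin (m + 1) → Type*} [∀ i, MeasurableSpace (E i)] :
    Measurable fun z : E 0 × (∀ i : Fin m, E i.succ) ↦ (Fin.cons z.1 z.2 : ∀ i, E i) := by
  have h : (fun z : E 0 × (∀ i : Fin m, E i.succ) ↦ (Fin.cons z.1 z.2 : ∀ i, E i)) =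
      (MeasurableEquiv.piFinSuccAbove E 0).symm := by
    ext1 z
    exact (Fin.insertNth_zero z.1 z.2).symm
  rw [h]
  exact (MeasurableEquiv.piFinSuccAbove E 0).symm.measurable

/-- The integral of a tensor product. -/
theorem lintegral_pi_prod {m : ℕ} {E : Fin m → Type*} [∀ i, MeasureSpace (E i)]
    [∀ i, SigmaFinite (volume : Measure (E i))] {f : ∀ i, E i → ℝ≥0∞}
    (hf : ∀ i, Measurable (f i)) :
    ∫⁻ x : ∀ i, E i, ∏ i, f i (x i) = ∏ i, ∫⁻ x, f i x := by
  induction m with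
  | zero => simp [lintegral_unique, volume_pi]
  | succ m ih =>
    rw [lintegral_pi_succ (by fun_prop), Fin.prod_univ_succ, ← ih fun i ↦ hf i.succ,
      ← lintegral_mul_const _ (hf 0)]
    refine lintegral_congr fun x0 ↦ ?_
    rw [← lintegral_const_mul _ (by fun_prop)]
    simp [Fin.prod_univ_succ]

/-- Norms of positive operators are submultiplicative under tensor products if `p < q`. -/
theorem KernelBound.pi {m : ℕ} {E : Fin m → Type*} [∀ i, MeasureSpace (E i)]
    [∀ i, SigmaFinite (volume : Measure (E i))] {K : ∀ i, E i → E i → ℝ≥0∞}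
    {a g : ∀ i, E i → ℝ≥0∞} {p q : ℝ} {C : Fin m → ℝ≥0∞} (hp : 0 < p) (hpq : p < q)
    (hK : ∀ i, Measurable (Function.uncurry (K i)))
    (ha : ∀ i, Measurable (a i)) (ha' : ∀ i x, a i x ≠ ∞) (hg : ∀ i, Measurable (g i))
    (h : ∀ i, KernelBound (K i) (a i) (g i) p q (C i)) :
    KernelBound (fun x y : ∀ i, E i ↦ ∏ i, K i (x i) (y i)) (fun x ↦ ∏ i, a i (x i))
      (fun x ↦ ∏ i, g i (x i)) p q (∏ i, C i) := by
  have hq : 0 < q := hp.trans hpq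
  induction m with
  | zero =>
    intro f hf
    simp [lintegral_unique, volume_pi, ← ENNReal.rpow_mul, hp.ne', hq.ne']
  | succ m ih =>
    intro f hf
    have ih := @ih (fun i ↦ E i.succ) _ _ (fun i ↦ K i.succ) (fun i ↦ a i.succ)
      (fun i ↦ g i.succ) (fun i ↦ C i.succ) (fun i ↦ hK _) (fun i ↦ ha _) (fun i ↦ ha' _)
      (fun i ↦ hg _) (fun i ↦ h _)
    set E' := ∀ i : Fin m, E i.succ
    set K' : E' → E' → ℝ≥0∞ := fun x y ↦ ∏ i, K i.succ (x i) (y i) with hK'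
    set a' : E' → ℝ≥0∞ := fun x ↦ ∏ i, a i.succ (x i) with ha'd
    set g' : E' → ℝ≥0∞ := fun x ↦ ∏ i, g i.succ (x i) with hg'd
    set C' := ∏ i : Fin m, C i.succ
    have hK'm : Measurable (Function.uncurry K') := by
      have : ∀ i : Fin m, Measurable fun z : E' × E' ↦ K i.succ (z.1 i) (z.2 i) := fun i ↦
        (hK i.succ).comp (by fun_prop : Measurable fun z : E' × E' ↦ (z.1 i, z.2 i))
      exact Finset.measurable_fun_prod _ fun i _ ↦ this i
    have ha'm : Measurable a' := by fun_prop
    have hg'm : Measurable g' := by fun_prop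
    have ha't : ∀ x, a' x ≠ ∞ := fun x ↦ ENNReal.prod_ne_top fun i _ ↦ ha' _ _
    set f2 : E 0 → E' → ℝ≥0∞ := fun y0 y' ↦ f (Fin.cons y0 y') with hf2
    have hf2m : Measurable (Function.uncurry f2) := hf.comp measurable_finCons
    -- the operator in the last variables
    set G : E 0 → E' → ℝ≥0∞ := fun y0 x' ↦ ∫⁻ y', K' x' y' * f2 y0 y' with hG
    have hGm : Measurable (Function.uncurry G) := by
      have : Measurable fun z : (E 0 × E') × E' ↦ K' z.1.2 z.2 * f2 z.1.1 z.2 := by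
        have h1 := hK'm.comp (by fun_prop : Measurable fun z : (E 0 × E') × E' ↦ (z.1.2, z.2))
        have h2 := hf2m.comp (by fun_prop : Measurable fun z : (E 0 × E') × E' ↦ (z.1.1, z.2))
        exact h1.mul h2
      exact this.lintegral_prod_right'
    have hT : ∀ x0 x', ∫⁻ y, (∏ i, K i ((Fin.cons x0 x' : ∀ i, E i) i) (y i)) * f y =
        ∫⁻ y0, K 0 x0 y0 * G y0 x' := by
      intro x0 x'
      have hKx : ∀ i, ∀ z, Measurable (K i z) := fun i z ↦ (hK i).of_uncurry_left
      rw [lintegral_pi_succ (by fun_prop)]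
      refine lintegral_congr fun y0 ↦ ?_
      rw [hG]
      simp only
      rw [← lintegral_const_mul]
      · refine lintegral_congr fun y' ↦ ?_
        simp [Fin.prod_univ_succ, hK', hf2, mul_assoc]
      · exact (hK'm.of_uncurry_left (x := x')).mul (hf2m.of_uncurry_left (x := y0))
    have hTm : Measurable fun z : E 0 × E' ↦ ∫⁻ y0, K 0 z.1 y0 * G y0 z.2 := by
      have : Measurable fun z : (E 0 × E') × E 0 ↦ K 0 z.1.1 z.2 * G z.2 z.1.2 := by
        have h1 := (hK 0).comp (by fun_prop : Measurable fun z : (E 0 × E') × E 0 ↦ (z.1.1, z.2))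
        have h2 := hGm.comp (by fun_prop : Measurable fun z : (E 0 × E') × E 0 ↦ (z.2, z.1.2))
        exact h1.mul h2
      exact this.lintegral_prod_right'
    have hL : ∫⁻ x : ∀ i, E i, (∫⁻ y, (∏ i, K i (x i) (y i)) * f y) ^ q * ∏ i, a i (x i) =
        ∫⁻ x', (∫⁻ x0, (∫⁻ y0, K 0 x0 y0 * G y0 x') ^ q * a 0 x0) * a' x' := by
      rw [lintegral_pi_succ, lintegral_lintegral_swap]
      · refine lintegral_congr fun x' ↦ ?_
        rw [← lintegral_mul_const]
        · refine lintegral_congr fun x0 ↦ ?_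
          rw [hT, Fin.prod_univ_succ]
          simp [ha'd, mul_assoc]
        · exact ((hTm.of_uncurry_right (y := x') (f := fun a b ↦ ∫⁻ y0, K 0 a y0 * G y0 b)).pow_const
            q).mul (ha 0)
      · have : Measurable fun z : E 0 × E' ↦
            (∫⁻ y0, K 0 z.1 y0 * G y0 z.2) ^ q * (a 0 z.1 * a' z.2) :=
          (hTm.pow_const q).mul (by fun_prop)
        convert this.aemeasurable using 1
        ext z
        simp only [Function.uncurry, hT]
        simp [Fin.prod_univ_succ, ha'd]
      · have : Measurable fun z : (∀ i, E i) × (∀ i, E i) ↦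
            (∏ i, K i (z.1 i) (z.2 i)) * f z.2 := by
          have h1 : ∀ i, Measurable fun z : (∀ i, E i) × (∀ i, E i) ↦ K i (z.1 i) (z.2 i) :=
            fun i ↦ (hK i).comp
              (by fun_prop : Measurable fun z : (∀ i, E i) × (∀ i, E i) ↦ (z.1 i, z.2 i))
          fun_prop
        have h2 := this.lintegral_prod_right' (ν := volume)
        fun_prop
    have hR : ∫⁻ x : ∀ i, E i, f x ^ p * ∏ i, g i (x i) =
        ∫⁻ x0, (∫⁻ x', f2 x0 x' ^ p * g' x') * g 0 x0 := by
      rw [lintegral_pi_succ (by fun_prop)]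
      refine lintegral_congr fun x0 ↦ ?_
      rw [← lintegral_mul_const]
      · refine lintegral_congr fun x' ↦ ?_
        simp only [Fin.prod_univ_succ, Fin.cons_zero, Fin.cons_succ, hf2, hg'd]
        ring
      · exact ((hf2m.of_uncurry_left (x := x0)).pow_const p).mul hg'm
    rw [hL, hR, Fin.prod_univ_succ]
    -- weights as densities
    set μ' : Measure E' := volume.withDensity a'
    set ν0 : Measure (E 0) := volume.withDensity (g 0)
    have : SigmaFinite μ' := SigmaFinite.withDensity_of_ne_top (.of_forall ha't)
    have hr : 1 < q / p := (one_lt_div hp).2 hpq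
    have hGpm : Measurable (Function.uncurry fun (x' : E') (y0 : E 0) ↦ G y0 x' ^ p) :=
      (hGm.comp measurable_swap).pow_const p
    have hsw : ∀ {F : E' → ℝ≥0∞}, ∫⁻ x', F x' * a' x' = ∫⁻ x', F x' ∂μ' := by
      intro F
      rw [lintegral_withDensity_eq_lintegral_mul_non_measurable _ ha'm
        (.of_forall fun x ↦ (ha't x).lt_top)]
      simp [mul_comm]
    have hsw0 : ∀ {F : E 0 → ℝ≥0∞}, Measurable F → ∫⁻ x', F x' * g 0 x' = ∫⁻ x', F x' ∂ν0 := by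
      intro F hF
      rw [lintegral_withDensity_eq_lintegral_mul _ (hg 0) hF]
      simp [mul_comm]
    have s1 : ∀ x', ∫⁻ x0, (∫⁻ y0, K 0 x0 y0 * G y0 x') ^ q * a 0 x0 ≤
        C 0 ^ q * (∫⁻ y0, G y0 x' ^ p ∂ν0) ^ (q / p) := by
      intro x'
      have hGx : Measurable fun y0 ↦ G y0 x' := hGm.of_uncurry_right
      have := ENNReal.rpow_le_rpow (h 0 (fun y0 ↦ G y0 x') hGx) hq.le
      rw [← ENNReal.rpow_mul, ENNReal.mul_rpow_of_nonneg _ _ hq.le, ← ENNReal.rpow_mul,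
        hsw0 (by fun_prop)] at this
      rw [one_div_mul_cancel hq.ne', ENNReal.rpow_one] at this
      convert this using 3
      ring
    have s2 : ∀ y0, (∫⁻ x', (G y0 x' ^ p) ^ (q / p) ∂μ') ^ (1 / (q / p)) ≤
        C' ^ p * ∫⁻ x', f2 y0 x' ^ p * g' x' := by
      intro y0
      have := ENNReal.rpow_le_rpow (ih (f2 y0) hf2m.of_uncurry_left) hp.le
      rw [← ENNReal.rpow_mul, ENNReal.mul_rpow_of_nonneg _ _ hp.le, ← ENNReal.rpow_mul,
        one_div_mul_cancel hp.ne', ENNReal.rpow_one, hsw] at this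
      simp_rw [← ENNReal.rpow_mul, mul_div_cancel₀ q hp.ne']
      convert this using 2
      field_simp
    calc _ ≤ (∫⁻ x', C 0 ^ q * (∫⁻ y0, G y0 x' ^ p ∂ν0) ^ (q / p) ∂μ') ^ (1 / q) := by
          rw [hsw]; gcongr with x'; exact s1 x'
      _ = C 0 * ((∫⁻ x', (∫⁻ y0, G y0 x' ^ p ∂ν0) ^ (q / p) ∂μ') ^ (1 / (q / p))) ^ (1 / p) := by
          have hm : Measurable fun x' ↦ ∫⁻ y0, G y0 x' ^ p ∂ν0 := hGpm.lintegral_prod_right'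
          rw [lintegral_const_mul _ (hm.pow_const _),
            ENNReal.mul_rpow_of_nonneg _ _ (by positivity), ← ENNReal.rpow_mul, ← ENNReal.rpow_mul,
            mul_one_div_cancel hq.ne', ENNReal.rpow_one]
          congr 2
          field_simp
      _ ≤ C 0 * (∫⁻ y0, (∫⁻ x', (G y0 x' ^ p) ^ (q / p) ∂μ') ^ (1 / (q / p)) ∂ν0) ^ (1 / p) := by
          gcongr
          exact lintegral_lintegral_rpow_le hr hGpm
      _ ≤ C 0 * (∫⁻ y0, (C' ^ p * ∫⁻ x', f2 y0 x' ^ p * g' x') ∂ν0) ^ (1 / p) := by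
          gcongr with y0; exact s2 y0
      _ = _ := by
          have hm : Measurable fun y0 ↦ ∫⁻ x', f2 y0 x' ^ p * g' x' := by
            have : Measurable fun z : E 0 × E' ↦ f2 z.1 z.2 ^ p * g' z.2 :=
              (hf2m.pow_const p).mul (by fun_prop)
            exact this.lintegral_prod_right'
          rw [lintegral_const_mul _ hm, ENNReal.mul_rpow_of_nonneg _ _ (by positivity),
            ← ENNReal.rpow_mul, mul_one_div_cancel hp.ne', ENNReal.rpow_one, hsw0 hm, mul_assoc]

theorem integrableOn_beta {b c : ℝ} (hb : 0 < b) (hc : 1 ≤ c) :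
    IntegrableOn (fun t : ℝ ↦ t ^ (b - 1) * (1 - t) ^ (c - 1)) (Ioo 0 1) := by
  have h1 : IntegrableOn (fun t : ℝ ↦ t ^ (b - 1)) (Ioo 0 1) :=
    (intervalIntegral.integrableOn_Ioo_rpow_iff one_pos).2 (by linarith)
  refine h1.mono' (by fun_prop) ?_
  filter_upwards [ae_restrict_mem measurableSet_Ioo] with t ht
  have h2 : 0 ≤ t ^ (b - 1) := Real.rpow_nonneg ht.1.le _
  have h3 : 0 ≤ (1 - t) ^ (c - 1) := Real.rpow_nonneg (by linarith [ht.2]) _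
  have h4 : (1 - t) ^ (c - 1) ≤ 1 :=
    Real.rpow_le_one (by linarith [ht.2]) (by linarith [ht.1]) (by linarith)
  rw [Real.norm_of_nonneg (mul_nonneg h2 h3)]
  exact mul_le_of_le_one_right h2 h4

theorem betaFn_pos {b c : ℝ} (hb : 0 < b) (hc : 1 ≤ c) : 0 < betaFn b c := by
  rw [betaFn, setIntegral_pos_iff_support_of_nonneg_ae]
  · have : Ioo (0 : ℝ) 1 ⊆ (Function.support fun t : ℝ ↦ t ^ (b - 1) * (1 - t) ^ (c - 1)) ∩
        Ioo 0 1 := fun t ht ↦ ⟨by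
          have h1 := Real.rpow_pos_of_pos ht.1 (b - 1)
          have h2 := Real.rpow_pos_of_pos (sub_pos.2 ht.2) (c - 1)
          exact (mul_pos h1 h2).ne', ht⟩
    exact lt_of_lt_of_le (by simp) (measure_mono this)
  · filter_upwards [ae_restrict_mem measurableSet_Ioo] with t ht
    exact mul_nonneg (Real.rpow_nonneg ht.1.le _) (Real.rpow_nonneg (by linarith [ht.2]) _)
  · exact integrableOn_beta hb hc

/-- The inverse of the incomplete Beta function, with its derivative. -/
theorem exists_inverse_incompleteBeta {b c : ℝ} (hb : 0 < b) (hc : 1 ≤ c) :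
    ∃ S : ℝ → ℝ, ∀ v ∈ Ioo 0 (betaFn b c), S v ∈ Ioo (0 : ℝ) 1 ∧
      HasDerivAt S (S v ^ (b - 1) * (1 - S v) ^ (c - 1))⁻¹ v := by
  set k : ℝ → ℝ := fun t ↦ t ^ (b - 1) * (1 - t) ^ (c - 1) with hk
  set J : ℝ → ℝ := fun x ↦ ∫ t in (0 : ℝ)..x, k t with hJ
  have hkint : IntervalIntegrable k volume 0 1 := by
    rw [intervalIntegrable_iff_integrableOn_Ioo_of_le zero_le_one]
    exact integrableOn_beta hb hc
  have hkpos : ∀ t ∈ Ioo (0 : ℝ) 1, 0 < k t := fun t ht ↦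
    mul_pos (Real.rpow_pos_of_pos ht.1 _) (Real.rpow_pos_of_pos (sub_pos.2 ht.2) _)
  have hcont : ContinuousOn J (Icc 0 1) := by
    have := intervalIntegral.continuousOn_primitive_interval' hkint (a := 0) (by simp)
    simpa using this
  have hkc : ContinuousOn k (Ioo 0 1) := by
    refine ContinuousOn.mul (fun t ht ↦ ?_) (fun t ht ↦ ?_)
    · exact (Real.continuousAt_rpow_const _ _ (.inl ht.1.ne')).continuousWithinAt
    · have := Real.continuousAt_rpow_const (1 - t) (c - 1) (.inl (sub_pos.2 ht.2).ne')
      exact (this.comp (f := fun t ↦ 1 - t) (by fun_prop)).continuousWithinAt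
  have hderiv : ∀ x ∈ Ioo (0 : ℝ) 1, HasDerivAt J (k x) x := by
    intro x hx
    refine intervalIntegral.integral_hasDerivAt_right ?_ ?_ ?_
    · refine hkint.mono_set ?_
      rw [uIcc_of_le hx.1.le, uIcc_of_le zero_le_one]
      exact Icc_subset_Icc_right hx.2.le
    · exact hkc.stronglyMeasurableAtFilter isOpen_Ioo x hx
    · exact hkc.continuousAt (isOpen_Ioo.mem_nhds hx)
  have hmono : StrictMonoOn J (Icc 0 1) := by
    refine strictMonoOn_of_deriv_pos (convex_Icc 0 1) hcont fun x hx ↦ ?_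
    rw [interior_Icc] at hx
    rw [(hderiv x hx).deriv]
    exact hkpos x hx
  have hJ0 : J 0 = 0 := by simp [hJ]
  have hJ1 : J 1 = betaFn b c := by
    simp only [hJ, betaFn]
    rw [intervalIntegral.integral_of_le zero_le_one, integral_Ioc_eq_integral_Ioo]
  have hsurj : ∀ v ∈ Ioo 0 (betaFn b c), ∃ x ∈ Ioo (0 : ℝ) 1, J x = v := by
    intro v hv
    have := intermediate_value_Ioo zero_le_one hcont
    rw [hJ0, hJ1] at this
    exact this hv
  choose! S hS hJS using hsurj
  have hSmono : StrictMonoOn S (Ioo 0 (betaFn b c)) := by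
    intro v hv w hw hvw
    by_contra! hle
    have := hmono.monotoneOn (Ioo_subset_Icc_self (hS w hw)) (Ioo_subset_Icc_self (hS v hv)) hle
    rw [hJS v hv, hJS w hw] at this
    exact absurd hvw (not_lt.2 this)
  refine ⟨S, fun v hv ↦ ⟨hS v hv, ?_⟩⟩
  have himg : S '' Ioo 0 (betaFn b c) = Ioo 0 1 := by
    apply Subset.antisymm
    · rintro _ ⟨w, hw, rfl⟩; exact hS w hw
    · intro x hx
      have hx' := Ioo_subset_Icc_self hx
      have hw : J x ∈ Ioo 0 (betaFn b c) := by
        rw [← hJ0, ← hJ1]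
        exact ⟨hmono (by simp) hx' hx.1, hmono hx' (by simp) hx.2⟩
      exact ⟨J x, hw, hmono.injOn (Ioo_subset_Icc_self (hS _ hw)) hx' (hJS _ hw)⟩
  have hSc : ContinuousAt S v := by
    refine hSmono.continuousAt_of_image_mem_nhds (isOpen_Ioo.mem_nhds hv) ?_
    rw [himg]
    exact isOpen_Ioo.mem_nhds (hS v hv)
  refine HasDerivAt.of_local_left_inverse hSc (hderiv _ (hS v hv)) (hkpos _ (hS v hv)).ne' ?_
  filter_upwards [isOpen_Ioo.mem_nhds hv] with w hw using hJS w hw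

/-- The sharp constant in the Bliss inequality. -/
noncomputable def blissConst (p q : ℝ) : ℝ :=
  (p - 1) * ((p / q) ^ (-(p / q)) * (1 - p / q) ^ (-(1 - p / q))) *
    betaFn (q * (p - 1) / (q - p)) (q / (q - p)) ^ (1 - p / q)

theorem blissConst_pos {p q : ℝ} (hp : 1 < p) (hpq : p < q) : 0 < blissConst p q := by
  have hq : 0 < q := by linarith
  have hp' : 0 < p - 1 := by linarith
  have hqp : 0 < q - p := by linarith
  have h1 : 0 < 1 - p / q := by rw [sub_pos, div_lt_one hq]; exact hpq
  have h2 : 0 < p / q := div_pos (by linarith) hq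
  have h3 : 0 < betaFn (q * (p - 1) / (q - p)) (q / (q - p)) :=
    betaFn_pos (by positivity) ((one_le_div hqp).2 (by linarith))
  unfold blissConst
  positivity

/-- The tangent line inequality for the power `p`. -/
theorem mul_rpow_sub_one_le {p x y : ℝ} (hp : 1 < p) (hx : 0 ≤ x) (hy : 0 ≤ y) :
    p * y ^ (p - 1) * x ≤ x ^ p + (p - 1) * y ^ p := by
  have hc : p.HolderConjugate (Real.conjExponent p) := Real.HolderConjugate.conjExponent hp
  have hp1 : 0 < p - 1 := by linarith
  have := Real.young_inequality_of_nonneg hx (Real.rpow_nonneg hy (p - 1)) hc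
  rw [← Real.rpow_mul hy] at this
  have e : (p - 1) * Real.conjExponent p = p := by rw [Real.conjExponent]; field_simp
  rw [e, Real.conjExponent] at this
  have h2 := mul_le_mul_of_nonneg_left this (by linarith : 0 ≤ p)
  calc _ = p * (x * y ^ (p - 1)) := by ring
    _ ≤ _ := h2
    _ = _ := by field_simp

/-- The arithmetic-geometric mean inequality behind the Bliss inequality. -/
theorem blissConst_mul_le {p q s W B : ℝ} (hp : 1 < p) (hpq : p < q) (hs : s ∈ Ioo (0 : ℝ) 1)
    (hW : 0 < W) (hB : 0 < B) :
    blissConst p q * B ^ (p / q - 1) * W ^ q ≤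
      (p - 1) * W ^ p * (s ^ (p - 1) - s ^ p + s ^ (p - 2) *
        (betaFn (q * (p - 1) / (q - p)) (q / (q - p)) / B * W ^ q *
          (s ^ (q * (p - 1) / (q - p) - 1) * (1 - s) ^ (q / (q - p) - 1))⁻¹)) := by
  obtain ⟨hs0, hs1⟩ := hs
  have hq : 0 < q := by linarith
  have hp0 : 0 < p := by linarith
  have hqp : 0 < q - p := by linarith
  have hp' : 0 < p - 1 := by linarith
  set b := q * (p - 1) / (q - p) with hb
  set c := q / (q - p) with hc
  set Z := betaFn b c with hZ
  have hZ0 : 0 < Z := betaFn_pos (by positivity) ((one_le_div hqp).2 (by linarith))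
  set θ := p / q with hθ
  have hθ0 : 0 < θ := by positivity
  have hθ1 : 0 < 1 - θ := by rw [sub_pos, div_lt_one hq]; exact hpq
  have hs1' : 0 < 1 - s := by linarith
  set X := s ^ (p - 1) * (1 - s) with hX
  set Y := s ^ (p - 2) * (Z / B * W ^ q * (s ^ (b - 1) * (1 - s) ^ (c - 1))⁻¹) with hY
  have hX0 : 0 < X := by positivity
  have hY0 : 0 < Y := by positivity
  have e1 : s ^ (p - 1) - s ^ p = X := by
    rw [hX, show p = (p - 1) + 1 by ring, Real.rpow_add hs0]; simp; ring
  have amgm := Real.geom_mean_le_arith_mean2_weighted hθ0.le hθ1.le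
    (by positivity : 0 ≤ X / θ) (by positivity : 0 ≤ Y / (1 - θ)) (by ring)
  rw [mul_div_cancel₀ _ hθ0.ne', mul_div_cancel₀ _ hθ1.ne', Real.div_rpow hX0.le hθ0.le,
    Real.div_rpow hY0.le hθ1.le] at amgm
  have e2 : X ^ θ * Y ^ (1 - θ) = Z ^ (1 - θ) * B ^ (θ - 1) * W ^ (q - p) := by
    have hl : Real.log (X ^ θ * Y ^ (1 - θ)) =
        Real.log (Z ^ (1 - θ) * B ^ (θ - 1) * W ^ (q - p)) := by
      rw [Real.log_mul (by positivity) (by positivity),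
        Real.log_mul (by positivity) (by positivity),
        Real.log_mul (by positivity) (by positivity)]
      rw [Real.log_rpow hX0, Real.log_rpow hY0, Real.log_rpow hZ0, Real.log_rpow hB,
        Real.log_rpow hW, hX, hY, Real.log_mul (by positivity) (by positivity),
        Real.log_mul (by positivity) (by positivity),
        Real.log_mul (by positivity) (by positivity),
        Real.log_mul (by positivity) (by positivity),
        Real.log_inv,
        Real.log_mul (by positivity) (by positivity),
        Real.log_div (by positivity) (by positivity),
        Real.log_rpow hs0, Real.log_rpow hs0, Real.log_rpow hs0, Real.log_rpow hs1',
        Real.log_rpow hW, hθ, hb, hc]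
      field_simp
      ring
    exact Real.log_injOn_pos (by simp only [mem_Ioi]; positivity)
      (by simp only [mem_Ioi]; positivity) hl
  have e3 : blissConst p q = (p - 1) * (θ ^ (-θ) * (1 - θ) ^ (-(1 - θ))) * Z ^ (1 - θ) := rfl
  have e4 : W ^ q = W ^ p * W ^ (q - p) := by rw [← Real.rpow_add hW]; ring_nf
  rw [e1]
  calc _ = (p - 1) * W ^ p * (X ^ θ / θ ^ θ * (Y ^ (1 - θ) / (1 - θ) ^ (1 - θ))) := by
        rw [e3, e4, Real.rpow_neg hθ0.le, Real.rpow_neg hθ1.le,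
          show X ^ θ / θ ^ θ * (Y ^ (1 - θ) / (1 - θ) ^ (1 - θ)) =
            (X ^ θ * Y ^ (1 - θ)) / (θ ^ θ * (1 - θ) ^ (1 - θ)) by ring, e2]
        ring
    _ ≤ _ := by gcongr

open Filter Topology in
/-- The Bliss inequality on a bounded interval, for positive continuous functions. -/
theorem bliss_of_continuous {p q T : ℝ} (hp : 1 < p) (hpq : p < q) (hT : 0 < T) {h : ℝ → ℝ}
    (hc : Continuous h) (hpos : ∀ t, 0 < h t) :
    IntervalIntegrable (fun t ↦ (∫ x in (0 : ℝ)..t, h x) ^ q * t ^ (-(q * (p - 1) / p) - 1))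
      volume 0 T ∧
    blissConst p q *
      (∫ t in (0 : ℝ)..T, (∫ x in (0 : ℝ)..t, h x) ^ q * t ^ (-(q * (p - 1) / p) - 1)) ^ (p / q) ≤
      ∫ t in (0 : ℝ)..T, h t ^ p := by
  have hq : 0 < q := by linarith
  have hp0 : 0 < p := by linarith
  have hqp : 0 < q - p := by linarith
  have hp' : 0 < p - 1 := by linarith
  set e := q * (p - 1) / p with he
  have heq : q - e = q / p := by rw [he]; field_simp; ring
  set u : ℝ → ℝ := fun t ↦ ∫ x in (0 : ℝ)..t, h x with hu
  set ρ : ℝ → ℝ := fun t ↦ u t ^ q * t ^ (-e - 1) with hρ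
  have hud : ∀ t, HasDerivAt u (h t) t := fun t ↦
    intervalIntegral.integral_hasDerivAt_right (hc.intervalIntegrable _ _)
      hc.aestronglyMeasurable.stronglyMeasurableAtFilter hc.continuousAt
  have huc : Continuous u := continuous_iff_continuousAt.2 fun t ↦ (hud t).continuousAt
  have hupos : ∀ t, 0 < t → 0 < u t := fun t ht ↦
    intervalIntegral.intervalIntegral_pos_of_pos (hc.intervalIntegrable _ _) hpos ht
  obtain ⟨M, hM⟩ : ∃ M, ∀ t ∈ Icc 0 T, h t ≤ M := by
    obtain ⟨M, hM⟩ := (isCompact_Icc (a := (0:ℝ)) (b := T)).bddAbove_image hc.continuousOn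
    exact ⟨M, fun t ht ↦ hM (mem_image_of_mem _ ht)⟩
  have hM0 : 0 < M := (hpos 0).trans_le (hM 0 ⟨le_rfl, hT.le⟩)
  have hule : ∀ t ∈ Icc 0 T, u t ≤ M * t := by
    intro t ht
    have := intervalIntegral.integral_mono_on ht.1 (hc.intervalIntegrable 0 t)
      (intervalIntegrable_const (μ := volume) (c := M)) fun x hx ↦
        hM x ⟨hx.1, hx.2.trans ht.2⟩
    simpa [mul_comm] using this
  have hρpos : ∀ t, 0 < t → 0 < ρ t := fun t ht ↦
    mul_pos (Real.rpow_pos_of_pos (hupos t ht) _) (Real.rpow_pos_of_pos ht _)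
  have hρc : ∀ t, 0 < t → ContinuousAt ρ t := fun t ht ↦
    (huc.continuousAt.rpow_const (.inl (hupos t ht).ne')).mul
      (Real.continuousAt_rpow_const _ _ (.inl ht.ne'))
  have hρcon : ContinuousOn ρ (Ioi 0) := fun t ht ↦ (hρc t ht).continuousWithinAt
  have hρi : IntervalIntegrable ρ volume 0 T := by
    rw [intervalIntegrable_iff_integrableOn_Ioo_of_le hT.le]
    have h1 : IntegrableOn (fun t : ℝ ↦ M ^ q * t ^ (q / p - 1)) (Ioo 0 T) :=
      ((intervalIntegral.integrableOn_Ioo_rpow_iff hT).2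
        (by linarith [div_pos hq hp0])).const_mul _
    refine h1.mono' ((hρcon.mono Ioo_subset_Ioi_self).aestronglyMeasurable measurableSet_Ioo) ?_
    filter_upwards [ae_restrict_mem measurableSet_Ioo] with t ht
    rw [Real.norm_of_nonneg (hρpos t ht.1).le]
    calc ρ t ≤ (M * t) ^ q * t ^ (-e - 1) := by
          have h0 := (hupos t ht.1).le
          have ht0 := ht.1.le
          have := hule t (Ioo_subset_Icc_self ht)
          simp only [hρ]
          gcongr
      _ = _ := by
          rw [Real.mul_rpow hM0.le ht.1.le, mul_assoc, ← Real.rpow_add ht.1, ← heq]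
          ring_nf
  refine ⟨hρi, ?_⟩
  set N : ℝ → ℝ := fun t ↦ ∫ x in (0 : ℝ)..t, ρ x with hN
  set B := N T with hB
  have hρi' : ∀ t ∈ Icc 0 T, IntervalIntegrable ρ volume 0 t := fun t ht ↦
    hρi.mono_set (by rw [uIcc_of_le ht.1, uIcc_of_le hT.le]; exact Icc_subset_Icc_right ht.2)
  have hNd : ∀ t ∈ Ioo 0 T, HasDerivAt N (ρ t) t := fun t ht ↦
    intervalIntegral.integral_hasDerivAt_right (hρi' t (Ioo_subset_Icc_self ht))
      (hρcon.stronglyMeasurableAtFilter isOpen_Ioi t ht.1) (hρc t ht.1)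
  have hNc : ContinuousOn N (Icc 0 T) := by
    have := intervalIntegral.continuousOn_primitive_interval' hρi (a := 0) (by simp)
    rwa [uIcc_of_le hT.le] at this
  have hNmono : StrictMonoOn N (Icc 0 T) := by
    refine strictMonoOn_of_deriv_pos (convex_Icc 0 T) hNc fun x hx ↦ ?_
    rw [interior_Icc] at hx
    rw [(hNd x hx).deriv]
    exact hρpos x hx.1
  have hN0 : N 0 = 0 := by simp [hN]
  have hT0 : (0 : ℝ) ∈ Icc 0 T := ⟨le_rfl, hT.le⟩
  have hTT : T ∈ Icc 0 T := ⟨hT.le, le_rfl⟩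
  have hB0 : 0 < B := by
    have := hNmono hT0 hTT hT
    rwa [hN0] at this
  set b := q * (p - 1) / (q - p) with hb
  set c := q / (q - p) with hcd
  set Z := betaFn b c with hZ
  have hZ0 : 0 < Z := betaFn_pos (by positivity) ((one_le_div hqp).2 (by linarith))
  obtain ⟨S, hS⟩ := exists_inverse_incompleteBeta (b := b) (c := c) (by positivity)
    ((one_le_div hqp).2 (by linarith))
  set s : ℝ → ℝ := fun t ↦ S (Z * (1 - N t / B)) with hs
  have hv : ∀ t ∈ Ioo 0 T, Z * (1 - N t / B) ∈ Ioo 0 Z := by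
    intro t ht
    have h1 : 0 < N t := by
      have := hNmono hT0 (Ioo_subset_Icc_self ht) ht.1
      rwa [hN0] at this
    have h2 : N t < B := hNmono (Ioo_subset_Icc_self ht) hTT ht.2
    have h3 : N t / B < 1 := (div_lt_one hB0).2 h2
    have h4 : 0 < N t / B := div_pos h1 hB0
    exact ⟨mul_pos hZ0 (by linarith), mul_lt_of_lt_one_right hZ0 (by linarith)⟩
  have hs01 : ∀ t ∈ Ioo 0 T, s t ∈ Ioo (0 : ℝ) 1 := fun t ht ↦ (hS _ (hv t ht)).1
  have hsd : ∀ t ∈ Ioo 0 T, HasDerivAt s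
      ((s t ^ (b - 1) * (1 - s t) ^ (c - 1))⁻¹ * (Z * -(ρ t / B))) t := fun t ht ↦
    (hS _ (hv t ht)).2.comp t ((((hNd t ht).div_const B).const_sub 1).const_mul Z)
  set c₀ := blissConst p q * B ^ (p / q - 1) with hc₀
  set P : ℝ → ℝ := fun t ↦ ∫ x in (0 : ℝ)..t, h x ^ p with hP
  have hpc : Continuous fun x ↦ h x ^ p := hc.rpow_const fun x ↦ .inl (hpos x).ne'
  have hPd : ∀ t, HasDerivAt P (h t ^ p) t := fun t ↦
    intervalIntegral.integral_hasDerivAt_right (hpc.intervalIntegrable _ _)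
      hpc.aestronglyMeasurable.stronglyMeasurableAtFilter hpc.continuousAt
  set V : ℝ → ℝ := fun t ↦ u t ^ p * (s t / t) ^ (p - 1) with hV
  set D : ℝ → ℝ := fun t ↦ P t - c₀ * N t - V t with hD
  have hDd : ∀ t ∈ Ioo 0 T, ∃ d, 0 ≤ d ∧ HasDerivAt D d t := by
    intro t ht
    have ht0 := ht.1
    have hst := hs01 t ht
    have hst0 := hst.1
    have hut := hupos t ht0
    have hsd' := (hsd t ht).div (hasDerivAt_id t) ht0.ne'
    have hVd := ((hud t).rpow_const (p := p) (.inl hut.ne')).mul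
      (hsd'.rpow_const (p := p - 1) (.inl (div_pos hst0 ht0).ne'))
    refine ⟨_, ?_, ((hPd t).sub ((hNd t ht).const_mul c₀)).sub hVd⟩
    set σ := (s t ^ (b - 1) * (1 - s t) ^ (c - 1))⁻¹ with hσ
    simp only [id, mul_one, Pi.div_apply]
    set W := u t / t * t ^ (1 / p) with hW
    have hW0 : 0 < W := by positivity
    have hb1 := blissConst_mul_le (s := s t) hp hpq hst hW0 hB0
    have hb2 := mul_rpow_sub_one_le hp (hpos t).le
      (by positivity : 0 ≤ u t / t * s t)
    have hWq : W ^ q = t * ρ t := by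
      rw [hW, Real.mul_rpow (by positivity) (by positivity), Real.div_rpow hut.le ht0.le,
        ← Real.rpow_mul ht0.le, hρ]
      simp only
      have h1 : t * t ^ (-e - 1) = t ^ (-e) := by
        nth_rewrite 1 [← Real.rpow_one t]; rw [← Real.rpow_add ht0]; ring_nf
      have h2 : t ^ (-e) = t ^ (1 / p * q) / t ^ q := by
        rw [← Real.rpow_sub ht0]; congr 1; linear_combination heq
      rw [show t * (u t ^ q * t ^ (-e - 1)) = u t ^ q * (t * t ^ (-e - 1)) by ring, h1, h2]
      ring
    have hWp : W ^ p = t * (u t / t) ^ p := by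
      rw [hW, Real.mul_rpow (by positivity) (by positivity), ← Real.rpow_mul ht0.le,
        one_div_mul_cancel hp0.ne', Real.rpow_one]
      ring
    rw [hWq, hWp, ← hb, ← hcd, ← hZ, ← hσ] at hb1
    have e1 : u t ^ (p - 1) * (s t / t) ^ (p - 1) = (u t / t * s t) ^ (p - 1) := by
      rw [← Real.mul_rpow hut.le (by positivity)]; congr 1; ring
    have e2 : u t ^ p * (s t / t) ^ (p - 1 - 1) =
        (u t / t) ^ p * s t ^ (p - 2) * t ^ 2 := by
      rw [Real.div_rpow hst0.le ht0.le, Real.div_rpow hut.le ht0.le,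
        show p - 1 - 1 = p - 2 by ring]
      have : t ^ p = t ^ (p - 2) * t ^ 2 := by
        rw [← Real.rpow_natCast, ← Real.rpow_add ht0]; norm_num
      rw [this]
      field_simp
    have e3 : s t ^ (p - 1) = s t ^ (p - 2) * s t := by
      nth_rewrite 3 [← Real.rpow_one (s t)]; rw [← Real.rpow_add hst0]; ring_nf
    rw [Real.mul_rpow (by positivity) hst0.le (z := p)] at hb2
    have hfin : c₀ * ρ t ≤ (p - 1) * (u t / t) ^ p * (s t ^ (p - 1) - s t ^ p + s t ^ (p - 2) *
        (Z / B * (t * ρ t) * σ)) := by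
      refine le_of_mul_le_mul_left ?_ ht0
      calc _ = c₀ * (t * ρ t) := by ring
        _ ≤ _ := hb1
        _ = _ := by ring
    have hgoal : h t * p * u t ^ (p - 1) * (s t / t) ^ (p - 1) +
        u t ^ p * ((σ * (Z * -(ρ t / B)) * t - s t) / t ^ 2 * (p - 1) * (s t / t) ^ (p - 1 - 1)) =
        p * (u t / t * s t) ^ (p - 1) * h t + (p - 1) * (u t / t) ^ p *
          (-(s t ^ (p - 2) * (Z / B * (t * ρ t) * σ)) - s t ^ (p - 1)) := by
      rw [← e1, e3]
      calc _ = h t * p * u t ^ (p - 1) * (s t / t) ^ (p - 1) +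
            (σ * (Z * -(ρ t / B)) * t - s t) / t ^ 2 * (p - 1) *
              (u t ^ p * (s t / t) ^ (p - 1 - 1)) := by ring
        _ = _ := by
          rw [e2]
          field_simp
    rw [hgoal]
    linarith
  have hDmono : MonotoneOn D (Ioo 0 T) := by
    choose! d hd0 hd using hDd
    refine monotoneOn_of_deriv_nonneg (convex_Ioo 0 T)
      (fun t ht ↦ (hd t ht).continuousAt.continuousWithinAt)
      (fun t ht ↦ ?_) (fun t ht ↦ ?_)
    · rw [interior_Ioo] at ht
      exact (hd t ht).differentiableAt.differentiableWithinAt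
    · rw [interior_Ioo] at ht
      rw [(hd t ht).deriv]
      exact hd0 t ht
  have hc₀0 : 0 < c₀ := mul_pos (blissConst_pos hp hpq) (Real.rpow_pos_of_pos hB0 _)
  have hcomp : ∀ t ∈ Ioo 0 T, ∀ a ∈ Ioo 0 t, -(c₀ * N a) - M ^ p * a ≤ P t - c₀ * N t := by
    intro t ht a ha
    have haT : a ∈ Ioo 0 T := ⟨ha.1, ha.2.trans ht.2⟩
    have h1 := hDmono haT ht ha.2.le
    have h2 : 0 ≤ V t := mul_nonneg (Real.rpow_nonneg (hupos t ht.1).le _)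
      (Real.rpow_nonneg (div_nonneg (hs01 t ht).1.le ht.1.le) _)
    have h3 : V a ≤ M ^ p * a := by
      have h4 := hule a (Ioo_subset_Icc_self haT)
      have h5 := (hupos a ha.1).le
      have h6 := (hs01 a haT)
      have h7 : s a / a ≤ 1 / a := by
        have := ha.1
        gcongr; exact h6.2.le
      calc V a ≤ (M * a) ^ p * (1 / a) ^ (p - 1) := by
            have := h6.1.le
            have := ha.1
            simp only [hV]
            gcongr
        _ = M ^ p * a := by
            have := Real.rpow_pos_of_pos ha.1 p
            rw [Real.mul_rpow hM0.le ha.1.le, one_div, Real.inv_rpow ha.1.le,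
              Real.rpow_sub ha.1, Real.rpow_one]
            field_simp
    have h8 : 0 ≤ P a := intervalIntegral.integral_nonneg ha.1.le fun x _ ↦
      Real.rpow_nonneg (hpos x).le _
    simp only [hD] at h1
    linarith
  have hcomp2 : ∀ t ∈ Ioo 0 T, 0 ≤ P t - c₀ * N t := by
    intro t ht
    have hlim : Tendsto (fun a ↦ -(c₀ * N a) - M ^ p * a) (𝓝[>] 0)
        (𝓝 (-(c₀ * N 0) - M ^ p * 0)) := by
      have h1 : Tendsto N (𝓝[>] 0) (𝓝 (N 0)) :=
        ((hNc 0 hT0).mono_of_mem_nhdsWithin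
          (mem_of_superset (Ioc_mem_nhdsGT hT) Ioc_subset_Icc_self))
      exact (h1.const_mul c₀).neg.sub
        ((continuous_id.tendsto' 0 0 rfl).mono_left nhdsWithin_le_nhds |>.const_mul _)
    rw [hN0] at hlim
    simp only [mul_zero, neg_zero, sub_zero] at hlim
    refine le_of_tendsto hlim ?_
    filter_upwards [Ioo_mem_nhdsGT ht.1] with a ha using hcomp t ht a ha
  have hlast : 0 ≤ P T - c₀ * N T := by
    have hPc : Continuous P := continuous_iff_continuousAt.2 fun t ↦ (hPd t).continuousAt
    have hlim : Tendsto (fun t ↦ P t - c₀ * N t) (𝓝[<] T) (𝓝 (P T - c₀ * N T)) := by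
      have h1 : Tendsto N (𝓝[<] T) (𝓝 (N T)) :=
        ((hNc T hTT).mono_of_mem_nhdsWithin
          (mem_of_superset (Ico_mem_nhdsLT hT) Ico_subset_Icc_self))
      exact (hPc.continuousAt.tendsto.mono_left nhdsWithin_le_nhds).sub (h1.const_mul c₀)
    refine ge_of_tendsto hlim ?_
    filter_upwards [Ioo_mem_nhdsLT hT] with t ht using hcomp2 t ht
  have : blissConst p q * B ^ (p / q) = c₀ * B := by
    rw [hc₀, Real.rpow_sub_one hB0.ne']
    field_simp
  change blissConst p q * B ^ (p / q) ≤ P T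
  rw [this]
  linarith

/-- The Bliss inequality on a bounded interval, for positive continuous functions, in terms of
lower Lebesgue integrals. -/
theorem bliss_lintegral_of_continuous {p q T : ℝ} (hp : 1 < p) (hpq : p < q) (hT : 0 < T)
    {h : ℝ → ℝ} (hc : Continuous h) (hpos : ∀ t, 0 < h t) :
    ENNReal.ofReal (blissConst p q) *
      (∫⁻ t in Ioo 0 T, (∫⁻ x in Ioo 0 t, ENNReal.ofReal (h x)) ^ q *
        ENNReal.ofReal (t ^ (-(q * (p - 1) / p) - 1))) ^ (p / q) ≤
      ∫⁻ t in Ioo 0 T, ENNReal.ofReal (h t) ^ p := by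
  have hq : 0 < q := by linarith
  have hp0 : 0 < p := by linarith
  obtain ⟨h1, h2⟩ := bliss_of_continuous hp hpq hT hc hpos
  have hu : ∀ t ∈ Ioo 0 T, ∫⁻ x in Ioo 0 t, ENNReal.ofReal (h x) =
      ENNReal.ofReal (∫ x in (0 : ℝ)..t, h x) := by
    intro t ht
    rw [intervalIntegral.integral_of_le ht.1.le, integral_Ioc_eq_integral_Ioo,
      ofReal_integral_eq_lintegral_ofReal _ (ae_of_all _ fun x ↦ (hpos x).le)]
    exact ((hc.intervalIntegrable 0 t).1).mono_set Ioo_subset_Ioc_self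
  have hu0 : ∀ t ∈ Ioo 0 T, 0 ≤ ∫ x in (0 : ℝ)..t, h x := fun t ht ↦
    intervalIntegral.integral_nonneg ht.1.le fun x _ ↦ (hpos x).le
  have hL : ∫⁻ t in Ioo 0 T, (∫⁻ x in Ioo 0 t, ENNReal.ofReal (h x)) ^ q *
        ENNReal.ofReal (t ^ (-(q * (p - 1) / p) - 1)) = ENNReal.ofReal
      (∫ t in (0 : ℝ)..T, (∫ x in (0 : ℝ)..t, h x) ^ q * t ^ (-(q * (p - 1) / p) - 1)) := by
    rw [intervalIntegral.integral_of_le hT.le, integral_Ioc_eq_integral_Ioo,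
      ofReal_integral_eq_lintegral_ofReal]
    · refine setLIntegral_congr_fun measurableSet_Ioo fun t ht ↦ ?_
      rw [hu t ht, ENNReal.ofReal_rpow_of_nonneg (hu0 t ht) hq.le,
        ENNReal.ofReal_mul (Real.rpow_nonneg (hu0 t ht) _)]
    · exact h1.1.mono_set Ioo_subset_Ioc_self
    · refine (ae_restrict_iff' measurableSet_Ioo).2 (ae_of_all _ fun t ht ↦ ?_)
      exact mul_nonneg (Real.rpow_nonneg (hu0 t ht) _) (Real.rpow_nonneg ht.1.le _)
  have hR : ∫⁻ t in Ioo 0 T, ENNReal.ofReal (h t) ^ p =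
      ENNReal.ofReal (∫ t in (0 : ℝ)..T, h t ^ p) := by
    rw [intervalIntegral.integral_of_le hT.le, integral_Ioc_eq_integral_Ioo,
      ofReal_integral_eq_lintegral_ofReal _
        (ae_of_all _ fun x ↦ Real.rpow_nonneg (hpos x).le _)]
    · exact lintegral_congr fun t ↦ ENNReal.ofReal_rpow_of_nonneg (hpos t).le hp0.le
    · exact (((hc.rpow_const fun x ↦ .inl (hpos x).ne').intervalIntegrable 0 T).1).mono_set
        Ioo_subset_Ioc_self
  have hN : 0 ≤ ∫ t in (0 : ℝ)..T,
      (∫ x in (0 : ℝ)..t, h x) ^ q * t ^ (-(q * (p - 1) / p) - 1) := by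
    rw [intervalIntegral.integral_of_le hT.le, integral_Ioc_eq_integral_Ioo]
    exact setIntegral_nonneg measurableSet_Ioo fun t ht ↦
      mul_nonneg (Real.rpow_nonneg (hu0 t ht) _) (Real.rpow_nonneg ht.1.le _)
  rw [hL, hR, ENNReal.ofReal_rpow_of_nonneg hN (by positivity),
    ← ENNReal.ofReal_mul (blissConst_pos hp hpq).le]
  exact ENNReal.ofReal_le_ofReal h2

open Filter Topology in
/-- The Bliss inequality on a bounded interval. -/
theorem bliss_Ioo {p q T : ℝ} (hp : 1 < p) (hpq : p < q) (hT : 0 < T)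
    {f : ℝ → ℝ≥0∞} (hf : Measurable f) :
    ENNReal.ofReal (blissConst p q) *
      (∫⁻ t in Ioo 0 T, (∫⁻ x in Ioo 0 t, f x) ^ q *
        ENNReal.ofReal (t ^ (-(q * (p - 1) / p) - 1))) ^ (p / q) ≤
      ∫⁻ t in Ioo 0 T, f t ^ p := by
  have hq : 0 < q := by linarith
  have hp0 : 0 < p := by linarith
  have hκ := blissConst_pos hp hpq
  set k := ENNReal.ofReal (blissConst p q) with hk
  have hk0 : k ≠ 0 := by simpa [hk] using hκ
  have hkt : k ≠ ∞ := ENNReal.ofReal_ne_top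
  by_cases hfin : ∫⁻ t in Ioo 0 T, f t ^ p = ∞
  · simp [hfin]
  set μ : Measure ℝ := volume.restrict (Ioo 0 T) with hμ
  set w : ℝ → ℝ≥0∞ := fun t ↦ ENNReal.ofReal (t ^ (-(q * (p - 1) / p) - 1)) with hw
  have hwm : Measurable w := by fun_prop
  have hfae : ∀ᵐ x ∂μ, f x < ∞ := by
    filter_upwards [ae_lt_top (hf.pow_const p) hfin] with x hx
    by_contra hx'
    simp only [not_lt, top_le_iff] at hx'
    simp [hx', hp0] at hx
  set P : ℝ≥0∞ := ENNReal.ofReal p with hP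
  have hP0 : P ≠ 0 := by simpa [hP] using hp0
  have hPt : P ≠ ∞ := ENNReal.ofReal_ne_top
  have hPr : P.toReal = p := ENNReal.toReal_ofReal hp0.le
  have hP1 : 1 ≤ P := by simpa [hP] using hp.le
  set g : ℝ → ℝ := fun x ↦ (f x).toReal with hg
  have hgf : ∀ᵐ x ∂μ, ‖g x‖ₑ = f x := by
    filter_upwards [hfae] with x hx
    rw [hg, Real.enorm_eq_ofReal ENNReal.toReal_nonneg, ENNReal.ofReal_toReal hx.ne]
  have hnorm : ∀ v : ℝ → ℝ, eLpNorm v P μ ^ p = ∫⁻ x, ‖v x‖ₑ ^ p ∂μ := by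
    intro v
    rw [eLpNorm_eq_lintegral_rpow_enorm_toReal hP0 hPt, hPr, ← ENNReal.rpow_mul,
      one_div_mul_cancel hp0.ne', ENNReal.rpow_one]
  set G := eLpNorm g P μ with hG
  have hGf : G ^ p = ∫⁻ t in Ioo 0 T, f t ^ p := by
    rw [hnorm]
    refine lintegral_congr_ae ?_
    filter_upwards [hgf] with x hx
    rw [hx]
  have hGt : G ≠ ∞ := by
    intro h
    rw [h, ENNReal.top_rpow_of_pos hp0] at hGf
    exact hfin hGf.symm
  have hgL : MemLp g P μ := ⟨hf.ennreal_toReal.aestronglyMeasurable, hGt.lt_top⟩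
  set ε : ℕ → ℝ := fun n ↦ 1 / ((n : ℝ) + 1) with hε
  have hεpos : ∀ n, 0 < ε n := fun n ↦ by positivity
  have hεlim : Tendsto (fun n ↦ ENNReal.ofReal (ε n)) atTop (𝓝 0) := by
    rw [← ENNReal.ofReal_zero]
    exact (ENNReal.continuous_ofReal.tendsto 0).comp
      (tendsto_one_div_add_atTop_nhds_zero_nat (𝕜 := ℝ))
  have happ : ∀ n, ∃ φ : BoundedContinuousFunction ℝ ℝ,
      eLpNorm (g - ⇑φ) P μ ≤ ENNReal.ofReal (ε n) ∧ MemLp φ P μ := fun n ↦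
    hgL.exists_boundedContinuous_eLpNorm_sub_le hPt (by simpa using hεpos n)
  choose φ hφ hφL using happ
  set h : ℕ → ℝ → ℝ := fun n x ↦ ‖φ n x‖ + ε n with hh
  have hhc : ∀ n, Continuous (h n) := fun n ↦ ((φ n).continuous.norm).add continuous_const
  have hhpos : ∀ n x, 0 < h n x := fun n x ↦ add_pos_of_nonneg_of_pos (norm_nonneg _) (hεpos n)
  set M : ℝ≥0∞ := μ univ ^ (1 / p) with hM
  have hMt : M ≠ ∞ := ENNReal.rpow_ne_top_of_nonneg (by positivity) (measure_ne_top _ _)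
  set M' : ℝ≥0∞ := μ univ ^ (1 - 1 / p) with hM'
  have hp1 : 0 ≤ 1 - 1 / p := by rw [sub_nonneg, div_le_one hp0]; exact hp.le
  have hMt' : M' ≠ ∞ := ENNReal.rpow_ne_top_of_nonneg hp1 (measure_ne_top _ _)
  have hup : ∀ n, ∫⁻ t in Ioo 0 T, ENNReal.ofReal (h n t) ^ p ≤
      (G + ENNReal.ofReal (ε n) + ENNReal.ofReal (ε n) * M) ^ p := by
    intro n
    have e1 : ∫⁻ t in Ioo 0 T, ENNReal.ofReal (h n t) ^ p = eLpNorm (h n) P μ ^ p := by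
      rw [hnorm]
      exact lintegral_congr fun x ↦ by rw [Real.enorm_eq_ofReal (hhpos n x).le]
    rw [e1]
    refine ENNReal.rpow_le_rpow ?_ hp0.le
    have e2 : eLpNorm (h n) P μ ≤ eLpNorm (fun x ↦ ‖φ n x‖) P μ +
        eLpNorm (fun _ : ℝ ↦ ε n) P μ :=
      eLpNorm_add_le (φ n).continuous.norm.aestronglyMeasurable
        aestronglyMeasurable_const hP1
    have e3 : eLpNorm (fun x ↦ ‖φ n x‖) P μ ≤ G + ENNReal.ofReal (ε n) := by
      rw [eLpNorm_norm]
      calc eLpNorm (φ n) P μ = eLpNorm (g - (g - ⇑(φ n))) P μ := by rw [sub_sub_cancel]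
        _ ≤ eLpNorm g P μ + eLpNorm (g - ⇑(φ n)) P μ :=
          eLpNorm_sub_le hgL.1 (hgL.1.sub (hφL n).1) hP1
        _ ≤ _ := by gcongr; exact hφ n
    have e4 : eLpNorm (fun _ : ℝ ↦ ε n) P μ = ENNReal.ofReal (ε n) * M := by
      rw [eLpNorm_const' _ hP0 hPt, hPr, Real.enorm_eq_ofReal (hεpos n).le]
    rw [e4] at e2
    exact e2.trans (by gcongr)
  have hlow : ∀ n, ∀ t ∈ Ioo 0 T, ∫⁻ x in Ioo 0 t, f x ≤
      (∫⁻ x in Ioo 0 t, ENNReal.ofReal (h n x)) + ENNReal.ofReal (ε n) * M' := by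
    intro n t ht
    have hsub : Ioo 0 t ⊆ Ioo 0 T := Ioo_subset_Ioo_right ht.2.le
    have hle : volume.restrict (Ioo 0 t) ≤ μ := Measure.restrict_mono_set _ hsub
    have hae : ∀ᵐ x ∂(volume.restrict (Ioo 0 t)), ‖g x‖ₑ = f x := ae_mono hle hgf
    calc ∫⁻ x in Ioo 0 t, f x ≤ ∫⁻ x in Ioo 0 t, (ENNReal.ofReal (h n x) + ‖(g - ⇑(φ n)) x‖ₑ) := by
          refine lintegral_mono_ae ?_
          filter_upwards [hae] with x hx
          rw [← hx]
          calc ‖g x‖ₑ = ‖φ n x + (g x - φ n x)‖ₑ := by rw [add_sub_cancel]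
            _ ≤ ‖φ n x‖ₑ + ‖g x - φ n x‖ₑ := enorm_add_le _ _
            _ ≤ _ := by
              refine add_le_add ?_ le_rfl
              rw [← ofReal_norm]
              exact ENNReal.ofReal_le_ofReal (by simp [hh, (hεpos n).le])
      _ = (∫⁻ x in Ioo 0 t, ENNReal.ofReal (h n x)) + ∫⁻ x in Ioo 0 t, ‖(g - ⇑(φ n)) x‖ₑ :=
          lintegral_add_left (hhc n).measurable.ennreal_ofReal _
      _ ≤ (∫⁻ x in Ioo 0 t, ENNReal.ofReal (h n x)) + ∫⁻ x, ‖(g - ⇑(φ n)) x‖ₑ ∂μ := by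
          gcongr
      _ ≤ _ := by
          gcongr
          rw [← eLpNorm_one_eq_lintegral_enorm]
          refine (eLpNorm_le_eLpNorm_mul_rpow_measure_univ hP1 (hgL.1.sub (hφL n).1)).trans ?_
          rw [ENNReal.toReal_one, hPr, div_one]
          gcongr
          exact hφ n
  set U : ℝ → ℝ≥0∞ := fun t ↦ ∫⁻ x in Ioo 0 t, f x with hU
  set Un : ℕ → ℝ → ℝ≥0∞ := fun n t ↦ ∫⁻ x in Ioo 0 t, ENNReal.ofReal (h n x) with hUn
  have hmono : ∀ v : ℝ → ℝ≥0∞, Measurable fun t ↦ ∫⁻ x in Ioo 0 t, v x := fun v ↦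
    Monotone.measurable fun s t hst ↦ lintegral_mono_set (Ioo_subset_Ioo_right hst)
  have hX : ∀ n, ∫⁻ t, Un n t ^ q * w t ∂μ ≤
      (k⁻¹ * (G + ENNReal.ofReal (ε n) + ENNReal.ofReal (ε n) * M) ^ p) ^ (q / p) := by
    intro n
    have := (bliss_lintegral_of_continuous hp hpq hT (hhc n) (hhpos n)).trans (hup n)
    rw [ENNReal.mul_le_iff_le_inv hk0 hkt] at this
    calc ∫⁻ t, Un n t ^ q * w t ∂μ = ((∫⁻ t, Un n t ^ q * w t ∂μ) ^ (p / q)) ^ (q / p) := by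
          rw [← ENNReal.rpow_mul, div_mul_div_cancel₀ hq.ne', div_self hp0.ne', ENNReal.rpow_one]
      _ ≤ _ := ENNReal.rpow_le_rpow this (by positivity)
  have hlim : Tendsto (fun n ↦
      (k⁻¹ * (G + ENNReal.ofReal (ε n) + ENNReal.ofReal (ε n) * M) ^ p) ^ (q / p)) atTop
      (𝓝 ((k⁻¹ * G ^ p) ^ (q / p))) := by
    have h1 : Tendsto (fun n ↦ G + ENNReal.ofReal (ε n) + ENNReal.ofReal (ε n) * M) atTop
        (𝓝 (G + 0 + 0 * M)) :=
      (tendsto_const_nhds.add hεlim).add (ENNReal.Tendsto.mul_const hεlim (.inr hMt))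
    rw [add_zero, zero_mul, add_zero] at h1
    exact ((ENNReal.continuous_rpow_const.tendsto _).comp
      (ENNReal.Tendsto.const_mul ((ENNReal.continuous_rpow_const.tendsto _).comp h1)
        (.inr (ENNReal.inv_ne_top.2 hk0))))
  have hfatou : ∫⁻ t, U t ^ q * w t ∂μ ≤ (k⁻¹ * G ^ p) ^ (q / p) := by
    calc ∫⁻ t, U t ^ q * w t ∂μ ≤ ∫⁻ t, liminf (fun n ↦ Un n t ^ q * w t) atTop ∂μ := by
          refine setLIntegral_mono' measurableSet_Ioo fun t ht ↦ ?_
          have h1 : Tendsto (fun n ↦ (U t - ENNReal.ofReal (ε n) * M') ^ q * w t) atTop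
              (𝓝 ((U t - 0 * M') ^ q * w t)) := by
            refine ENNReal.Tendsto.mul_const ((ENNReal.continuous_rpow_const.tendsto _).comp
              (ENNReal.Tendsto.sub tendsto_const_nhds
                (ENNReal.Tendsto.mul_const hεlim (.inr hMt')) (.inr (by simp))))
              (.inr ENNReal.ofReal_ne_top)
          rw [zero_mul, tsub_zero] at h1
          rw [← h1.liminf_eq]
          refine liminf_le_liminf (Eventually.of_forall fun n ↦ ?_)
          gcongr
          exact tsub_le_iff_right.2 (hlow n t ht)
      _ ≤ liminf (fun n ↦ ∫⁻ t, Un n t ^ q * w t ∂μ) atTop :=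
          lintegral_liminf_le fun n ↦ ((hmono _).pow_const _).mul hwm
      _ ≤ liminf (fun n ↦
          (k⁻¹ * (G + ENNReal.ofReal (ε n) + ENNReal.ofReal (ε n) * M) ^ p) ^ (q / p)) atTop :=
          liminf_le_liminf (Eventually.of_forall hX)
      _ = _ := hlim.liminf_eq
  rw [← hGf, ENNReal.mul_le_iff_le_inv hk0 hkt]
  calc (∫⁻ t, U t ^ q * w t ∂μ) ^ (p / q) ≤ ((k⁻¹ * G ^ p) ^ (q / p)) ^ (p / q) :=
        ENNReal.rpow_le_rpow hfatou (by positivity)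
    _ = _ := by
      rw [← ENNReal.rpow_mul, div_mul_div_cancel₀ hp0.ne', div_self hq.ne', ENNReal.rpow_one]

open Filter Topology in
/-- The **Bliss inequality** on the half-line. -/
theorem bliss {p q : ℝ} (hp : 1 < p) (hpq : p < q) {f : ℝ → ℝ≥0∞} (hf : Measurable f) :
    ENNReal.ofReal (blissConst p q) *
      (∫⁻ t in Ioi 0, (∫⁻ x in Ioo 0 t, f x) ^ q *
        ENNReal.ofReal (t ^ (-(q * (p - 1) / p) - 1))) ^ (p / q) ≤
      ∫⁻ t in Ioi 0, f t ^ p := by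
  have hU : (⋃ n : ℕ, Ioo (0 : ℝ) ((n : ℝ) + 1)) = Ioi 0 := by
    ext x
    simp only [mem_iUnion, mem_Ioo, mem_Ioi]
    refine ⟨fun ⟨n, h⟩ ↦ h.1, fun h ↦ ?_⟩
    obtain ⟨n, hn⟩ := exists_nat_gt x
    exact ⟨n, h, by linarith⟩
  have hdir : Directed (· ⊆ ·) fun n : ℕ ↦ Ioo (0 : ℝ) ((n : ℝ) + 1) :=
    Monotone.directed_le fun m n h ↦ Ioo_subset_Ioo_right (by gcongr)
  have hlim : ∀ v : ℝ → ℝ≥0∞, Tendsto (fun n : ℕ ↦ ∫⁻ t in Ioo (0 : ℝ) ((n : ℝ) + 1), v t) atTop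
      (𝓝 (∫⁻ t in Ioi 0, v t)) := by
    intro v
    rw [← hU, setLIntegral_iUnion_of_directed _ hdir]
    exact tendsto_atTop_iSup fun m n h ↦ lintegral_mono_set (Ioo_subset_Ioo_right (by gcongr))
  refine le_of_tendsto_of_tendsto' (ENNReal.Tendsto.const_mul
    ((ENNReal.continuous_rpow_const.tendsto _).comp (hlim _)) (.inr ENNReal.ofReal_ne_top))
    (hlim _) fun n ↦ bliss_Ioo hp hpq (by positivity) hf

section Polar

variable {E : Type*} [NormedAddCommGroup E] [NormedSpace ℝ E] [FiniteDimensional ℝ E]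
  [MeasurableSpace E] [BorelSpace E] [Nontrivial E] (μ : Measure E) [μ.IsAddHaarMeasure]

/-- Integration in polar coordinates for lower Lebesgue integrals. -/
theorem lintegral_eq_lintegral_Ioi_toSphere {f : E → ℝ≥0∞} (hf : Measurable f) :
    ∫⁻ x, f x ∂μ = ∫⁻ r in Ioi (0 : ℝ), ENNReal.ofReal (r ^ (Module.finrank ℝ E - 1)) *
      ∫⁻ θ, f (r • (θ : E)) ∂μ.toSphere := by
  have hm : Measurable fun z : ℝ × Metric.sphere (0 : E) 1 ↦ f (z.1 • (z.2 : E)) :=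
    hf.comp (measurable_fst.smul (measurable_subtype_coe.comp measurable_snd))
  have hG : Measurable fun r : ℝ ↦ ∫⁻ θ, f (r • (θ : E)) ∂μ.toSphere := hm.lintegral_prod_right'
  calc ∫⁻ x, f x ∂μ = ∫⁻ x in ({0}ᶜ : Set E), f x ∂μ := by
        rw [restrict_compl_singleton]
    _ = ∫⁻ x : ({0}ᶜ : Set E), f x ∂(μ.comap (↑)) :=
        (lintegral_subtype_comap (measurableSet_singleton _).compl _).symm
    _ = ∫⁻ z : Metric.sphere (0 : E) 1 × Ioi (0 : ℝ), f ((z.2 : ℝ) • (z.1 : E))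
          ∂(μ.toSphere.prod (.volumeIoiPow (Module.finrank ℝ E - 1))) := by
        rw [← μ.measurePreserving_homeomorphUnitSphereProd.lintegral_comp_emb
          (Homeomorph.measurableEmbedding _)]
        refine lintegral_congr fun x ↦ ?_
        congr 1
        have hx : ‖(x : E)‖ ≠ 0 := norm_ne_zero_iff.2 x.2
        simp [smul_smul, hx]
    _ = ∫⁻ r : Ioi (0 : ℝ), ∫⁻ θ, f ((r : ℝ) • (θ : E)) ∂μ.toSphere
          ∂(.volumeIoiPow (Module.finrank ℝ E - 1)) := by
        rw [lintegral_prod_symm']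
        exact hm.comp ((measurable_subtype_coe.comp measurable_snd).prodMk measurable_fst)
    _ = _ := by
        refine (lintegral_withDensity_eq_lintegral_mul _
          (by fun_prop) (hG.comp measurable_subtype_coe)).trans ?_
        exact lintegral_subtype_comap measurableSet_Ioi fun r : ℝ ↦
          ENNReal.ofReal (r ^ (Module.finrank ℝ E - 1)) * ∫⁻ θ, f (r • (θ : E)) ∂μ.toSphere

/-- Integration in polar coordinates, with the radius parametrized as `t ^ (1 / a)`. -/
theorem lintegral_eq_lintegral_Ioi_rpow_toSphere {a : ℝ} (ha : 0 < a) {f : E → ℝ≥0∞}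
    (hf : Measurable f) :
    ∫⁻ x, f x ∂μ = ∫⁻ t in Ioi (0 : ℝ),
      ENNReal.ofReal (1 / a * t ^ ((Module.finrank ℝ E : ℝ) / a - 1)) *
        ∫⁻ θ, f (t ^ (1 / a) • (θ : E)) ∂μ.toSphere := by
  have himg : (fun t : ℝ ↦ t ^ (1 / a)) '' Ioi 0 = Ioi 0 := by
    ext y
    refine ⟨fun ⟨x, hx, h⟩ ↦ h ▸ Real.rpow_pos_of_pos hx _, fun hy ↦
      ⟨y ^ a, Real.rpow_pos_of_pos hy _, ?_⟩⟩
    simp only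
    rw [← Real.rpow_mul (le_of_lt hy), mul_one_div_cancel ha.ne', Real.rpow_one]
  have hd : ∀ t ∈ Ioi (0 : ℝ), HasDerivWithinAt (fun t : ℝ ↦ t ^ (1 / a))
      (1 / a * t ^ (1 / a - 1)) (Ioi 0) t := fun t ht ↦
    (Real.hasDerivAt_rpow_const (.inl (ne_of_gt ht))).hasDerivWithinAt
  have hmono : MonotoneOn (fun t : ℝ ↦ t ^ (1 / a)) (Ioi 0) := fun s hs t _ hst ↦
    Real.rpow_le_rpow (le_of_lt hs) hst (by positivity)
  have hn : 1 ≤ Module.finrank ℝ E := Module.finrank_pos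
  rw [lintegral_eq_lintegral_Ioi_toSphere μ hf, ← himg,
    lintegral_image_eq_lintegral_deriv_mul_of_monotoneOn measurableSet_Ioi hd hmono, himg]
  refine setLIntegral_congr_fun measurableSet_Ioi fun t ht ↦ ?_
  have ht0 : (0 : ℝ) < t := ht
  rw [← mul_assoc, ← ENNReal.ofReal_mul (by positivity)]
  congr 2
  rw [← Real.rpow_natCast, ← Real.rpow_mul ht0.le, mul_assoc, ← Real.rpow_add ht0]
  congr 2
  push_cast [hn]
  field_simp
  ring

end Polar

/-- The Beta integral as a lower Lebesgue integral. -/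
theorem lintegral_beta {u v : ℝ} (hu : 0 < u) (hv : 0 < v) :
    ∫⁻ x in Ioo (0 : ℝ) 1, ENNReal.ofReal (x ^ (u - 1) * (1 - x) ^ (v - 1)) =
      ENNReal.ofReal (ProbabilityTheory.beta u v) := by
  have hb := ProbabilityTheory.beta_pos hu hv
  have h := ProbabilityTheory.lintegral_betaPDF_eq_one hu hv
  rw [ProbabilityTheory.lintegral_betaPDF] at h
  simp_rw [mul_assoc, ENNReal.ofReal_mul (one_div_pos.2 hb).le] at h
  rw [lintegral_const_mul' _ _ ENNReal.ofReal_ne_top] at h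
  calc _ = ENNReal.ofReal (ProbabilityTheory.beta u v) *
        (ENNReal.ofReal (1 / ProbabilityTheory.beta u v) *
          ∫⁻ x in Ioo (0 : ℝ) 1, ENNReal.ofReal (x ^ (u - 1) * (1 - x) ^ (v - 1))) := by
        rw [← mul_assoc, ← ENNReal.ofReal_mul hb.le, mul_one_div_cancel hb.ne', ENNReal.ofReal_one,
          one_mul]
    _ = _ := by rw [h, mul_one]

theorem betaFn_eq_beta {u v : ℝ} (hu : 0 < u) (hv : 0 < v) :
    betaFn u v = ProbabilityTheory.beta u v := by
  rw [betaFn, integral_eq_lintegral_of_nonneg_ae, lintegral_beta hu hv,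
    ENNReal.toReal_ofReal (ProbabilityTheory.beta_pos hu hv).le]
  · refine ae_restrict_of_forall_mem measurableSet_Ioo fun x hx ↦ ?_
    have h1 : 0 < 1 - x := by linarith [hx.2]
    have h2 := hx.1
    change 0 ≤ x ^ (u - 1) * (1 - x) ^ (v - 1)
    positivity
  · exact Measurable.aestronglyMeasurable (by fun_prop)

theorem mul_beta_add_one {b c : ℝ} (hb : 0 < b) (hc : 0 < c) :
    c * ProbabilityTheory.beta c (b + 1) = b * ProbabilityTheory.beta b (c + 1) := by
  simp only [ProbabilityTheory.beta]
  rw [Real.Gamma_add_one hb.ne', Real.Gamma_add_one hc.ne',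
    show c + (b + 1) = b + (c + 1) by ring]
  ring

/-- A power of `blissConst` in terms of the Beta function. -/
theorem blissConst_rpow_neg {p q : ℝ} (hp : 1 < p) (hpq : p < q) :
    blissConst p q ^ (-(1 / p)) = ((p / (p - 1)) / q) ^ (1 / q) *
      ((p / (q - p)) * betaFn (p / (q - p)) (p * q / ((q / (q - 1)) * (q - p)))) ^
        (1 / q - 1 / p) := by
  have hp0 : 0 < p := by linarith
  have hq : 0 < q := by linarith
  have hq1 : 0 < q - 1 := by linarith
  have hp1 : 0 < p - 1 := by linarith
  have hqp : 0 < q - p := by linarith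
  have hb : 0 < q * (p - 1) / (q - p) := by positivity
  have hc : 0 < p / (q - p) := by positivity
  set Z := betaFn (q * (p - 1) / (q - p)) (q / (q - p)) with hZ
  have hc1 : p / (q - p) + 1 = q / (q - p) := by field_simp; ring
  have hb1 : p * q / ((q / (q - 1)) * (q - p)) = q * (p - 1) / (q - p) + 1 := by
    field_simp; ring
  have hZ0 : 0 < Z := by
    rw [hZ, betaFn_eq_beta hb (by positivity)]
    exact ProbabilityTheory.beta_pos hb (by positivity)
  have hrec : (p / (q - p)) * betaFn (p / (q - p)) (p * q / ((q / (q - 1)) * (q - p))) =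
      q * (p - 1) / (q - p) * Z := by
    rw [hb1, betaFn_eq_beta hc (by positivity), mul_beta_add_one hb hc, hc1, hZ,
      betaFn_eq_beta hb (by positivity)]
  rw [hrec, blissConst, ← hZ]
  set x := p / q with hx
  have hx0 : 0 < x := by positivity
  have hx1 : 0 < 1 - x := by rw [hx, sub_pos, div_lt_one hq]; exact hpq
  have e1 : p / (p - 1) / q = ((p - 1) / x)⁻¹ := by rw [hx]; field_simp
  have e2 : q * (p - 1) / (q - p) = (p - 1) / (1 - x) := by rw [hx]; field_simp
  have e3 : 1 / q = x * (1 / p) := by rw [hx]; field_simp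
  rw [e1, e2, e3, show x * (1 / p) - 1 / p = (1 - x) * (-(1 / p)) by ring,
    show x * (1 / p) = x * -1 * -(1 / p) by ring, Real.rpow_mul (by positivity),
    Real.rpow_mul (show 0 ≤ (p - 1) / (1 - x) * Z by positivity),
    ← Real.mul_rpow (by positivity) (by positivity)]
  congr 1
  rw [mul_neg_one, Real.rpow_neg (show 0 ≤ ((p - 1) / x)⁻¹ by positivity),
    Real.inv_rpow (show 0 ≤ (p - 1) / x by positivity), inv_inv,
    Real.mul_rpow (by positivity) hZ0.le, ← mul_assoc (((p - 1) / x) ^ x)]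
  congr 1
  rw [Real.div_rpow hp1.le hx0.le, Real.div_rpow hp1.le hx1.le, Real.rpow_neg hx0.le,
    Real.rpow_neg hx1.le]
  have : p - 1 = (p - 1) ^ x * (p - 1) ^ (1 - x) := by
    rw [← Real.rpow_add hp1, add_sub_cancel, Real.rpow_one]
  nth_rewrite 1 [this]
  field_simp

/-- The substitution `s = 1 / (1 + t ^ r)` on the half-line. -/
theorem lintegral_Ioi_eq_lintegral_Ioo {r : ℝ} (hr : 0 < r) (G : ℝ → ℝ≥0∞) :
    ∫⁻ t in Ioi (0 : ℝ), G t = ∫⁻ s in Ioo (0 : ℝ) 1,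
      ENNReal.ofReal (1 / r * ((1 - s) / s) ^ (1 / r - 1) * (1 / s ^ 2)) *
        G (((1 - s) / s) ^ (1 / r)) := by
  set ψ : ℝ → ℝ := fun s ↦ ((1 - s) / s) ^ (1 / r) with hψ
  have hpos : ∀ s ∈ Ioo (0 : ℝ) 1, 0 < (1 - s) / s := fun s hs ↦
    div_pos (by linarith [hs.2]) hs.1
  have himg : ψ '' Ioo 0 1 = Ioi 0 := by
    ext t
    refine ⟨fun ⟨s, hs, h⟩ ↦ h ▸ Real.rpow_pos_of_pos (hpos s hs) _, fun ht ↦ ?_⟩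
    have ht0 : 0 < t := ht
    have h1 : 0 < t ^ r := Real.rpow_pos_of_pos ht0 r
    refine ⟨1 / (1 + t ^ r), ⟨by positivity, by rw [div_lt_one (by positivity)]; linarith⟩, ?_⟩
    have h2 : (1 - 1 / (1 + t ^ r)) / (1 / (1 + t ^ r)) = t ^ r := by field_simp; ring
    simp only [hψ]
    rw [h2, ← Real.rpow_mul ht0.le, mul_one_div_cancel hr.ne', Real.rpow_one]
  have hd : ∀ s ∈ Ioo (0 : ℝ) 1, HasDerivWithinAt ψ
      (-(1 / r * ((1 - s) / s) ^ (1 / r - 1) * (1 / s ^ 2))) (Ioo 0 1) s := by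
    intro s hs
    have hs0 : s ≠ 0 := hs.1.ne'
    have h1 : HasDerivAt (fun s : ℝ ↦ (1 - s) / s) (-(1 / s ^ 2)) s := by
      refine (((hasDerivAt_id' s).const_sub 1).fun_div (hasDerivAt_id' s) hs0).congr_deriv ?_
      ring
    refine ((h1.rpow_const (p := 1 / r) (.inl (hpos s hs).ne')).congr_deriv ?_).hasDerivWithinAt
    ring
  have hanti : AntitoneOn ψ (Ioo 0 1) := by
    intro s hs t ht hst
    refine Real.rpow_le_rpow (hpos t ht).le ?_ (by positivity)
    have := hs.1
    have := ht.1
    rw [div_le_div_iff₀ ht.1 hs.1]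
    nlinarith
  rw [← himg, lintegral_image_eq_lintegral_deriv_mul_of_antitoneOn measurableSet_Ioo hd hanti]
  simp only [neg_neg, hψ]

theorem lintegral_Ioo_one_add_rpow {r : ℝ} (hr : 0 < r) {t : ℝ} (ht : 0 < t) :
    ∫⁻ x in Ioo 0 t, ENNReal.ofReal ((1 + x ^ r) ^ (-(1 / r) - 1)) =
      ENNReal.ofReal (t * (1 + t ^ r) ^ (-(1 / r))) := by
  have hpos : ∀ x : ℝ, 0 ≤ x → 0 < 1 + x ^ r := fun x hx ↦ by positivity
  have hcr : ContinuousOn (fun x : ℝ ↦ 1 + x ^ r) (Icc 0 t) :=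
    (continuous_const.add (Real.continuous_rpow_const hr.le)).continuousOn
  have hc : ContinuousOn (fun x : ℝ ↦ x * (1 + x ^ r) ^ (-(1 / r))) (Icc 0 t) :=
    continuousOn_id.mul (hcr.rpow_const fun x hx ↦ .inl (hpos x hx.1).ne')
  have hi : IntervalIntegrable (fun x : ℝ ↦ (1 + x ^ r) ^ (-(1 / r) - 1)) volume 0 t := by
    refine ContinuousOn.intervalIntegrable ?_
    rw [uIcc_of_le ht.le]
    exact hcr.rpow_const fun x hx ↦ .inl (hpos x hx.1).ne'
  have hd : ∀ x ∈ Ioo 0 t, HasDerivAt (fun x : ℝ ↦ x * (1 + x ^ r) ^ (-(1 / r)))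
      ((1 + x ^ r) ^ (-(1 / r) - 1)) x := by
    intro x hx
    have hx0 := hx.1
    have h := hpos x hx0.le
    have h1 : HasDerivAt (fun x : ℝ ↦ 1 + x ^ r) (r * x ^ (r - 1)) x :=
      (Real.hasDerivAt_rpow_const (.inl hx0.ne')).const_add 1
    refine ((hasDerivAt_id' x).fun_mul
      (h1.rpow_const (p := -(1 / r)) (.inl h.ne'))).congr_deriv ?_
    rw [Real.rpow_sub_one h.ne', Real.rpow_sub_one hx0.ne']
    field_simp
    ring
  have := intervalIntegral.integral_eq_sub_of_hasDerivAt_of_le ht.le hc hd hi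
  rw [zero_mul, sub_zero, intervalIntegral.integral_of_le ht.le,
    integral_Ioc_eq_integral_Ioo] at this
  rw [← this, ofReal_integral_eq_lintegral_ofReal (hi.1.mono_set Ioo_subset_Ioc_self)]
  exact ae_restrict_of_forall_mem measurableSet_Ioo fun x hx ↦
    (Real.rpow_pos_of_pos (hpos x hx.1.le) _).le

/-- Extremal functions exist for the Bliss inequality. -/
theorem exists_bliss_eq {p q : ℝ} (hp : 1 < p) (hpq : p < q) :
    ∃ H : ℝ → ℝ, Measurable H ∧ (∀ t, 0 < t → 0 < H t) ∧
      ∫⁻ t in Ioi 0, ENNReal.ofReal (H t) ^ p ≠ 0 ∧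
      ∫⁻ t in Ioi 0, ENNReal.ofReal (H t) ^ p ≠ ∞ ∧
      ∫⁻ t in Ioi 0, ENNReal.ofReal (H t) ^ p = ENNReal.ofReal (blissConst p q) *
        (∫⁻ t in Ioi 0, (∫⁻ x in Ioo 0 t, ENNReal.ofReal (H x)) ^ q *
          ENNReal.ofReal (t ^ (-(q * (p - 1) / p) - 1))) ^ (p / q) := by
  have hp0 : 0 < p := by linarith
  have hq : 0 < q := by linarith
  have hp1 : 0 < p - 1 := by linarith
  have hqp : 0 < q - p := by linarith
  set r := (q - p) / p with hr
  have hr0 : 0 < r := by positivity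
  set b := q * (p - 1) / (q - p) with hb
  have hb0 : 0 < b := by positivity
  set c := p / (q - p) with hc
  have hc0 : 0 < c := by positivity
  have hcr : 1 / r = c := by rw [hr, hc]; field_simp
  have hA : ∫⁻ t in Ioi (0 : ℝ), ENNReal.ofReal ((1 + t ^ r) ^ (-(1 / r) - 1)) ^ p =
      ENNReal.ofReal (c * ProbabilityTheory.beta (b + 1) c) := by
    rw [lintegral_Ioi_eq_lintegral_Ioo hr0, ENNReal.ofReal_mul hc0.le, ← lintegral_beta
      (by positivity) hc0, ← lintegral_const_mul' _ _ ENNReal.ofReal_ne_top]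
    refine setLIntegral_congr_fun measurableSet_Ioo fun s hs ↦ ?_
    have hs0 : 0 < s := hs.1
    have hs1 : 0 < 1 - s := by linarith [hs.2]
    have h1 : 0 < (1 - s) / s := by positivity
    have h2 : 1 + (((1 - s) / s) ^ (1 / r)) ^ r = s⁻¹ := by
      rw [← Real.rpow_mul h1.le, one_div_mul_cancel hr0.ne', Real.rpow_one]; field_simp; ring
    simp only [h2]
    rw [ENNReal.ofReal_rpow_of_nonneg (by positivity) hp0.le, ← ENNReal.ofReal_mul (by positivity),
      ← ENNReal.ofReal_mul hc0.le, hcr]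
    congr 1
    rw [Real.inv_rpow hs0.le, ← Real.rpow_neg hs0.le, ← Real.rpow_mul hs0.le,
      Real.div_rpow hs1.le hs0.le, one_div, ← Real.rpow_natCast, ← Real.rpow_neg hs0.le,
      div_eq_mul_inv, ← Real.rpow_neg hs0.le]
    have h3 : s ^ (b + 1 - 1) = s ^ (-(c - 1)) * s ^ (-((2 : ℕ) : ℝ)) * s ^ (-(-c - 1) * p) := by
      rw [← Real.rpow_add hs0, ← Real.rpow_add hs0]
      congr 1
      rw [hb, hc]
      push_cast
      field_simp
      ring
    rw [h3]
    ring
  have hB : ∫⁻ t in Ioi (0 : ℝ), (∫⁻ x in Ioo 0 t, ENNReal.ofReal ((1 + x ^ r) ^ (-(1 / r) - 1))) ^ q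
        * ENNReal.ofReal (t ^ (-(q * (p - 1) / p) - 1)) =
      ENNReal.ofReal (c * ProbabilityTheory.beta b (c + 1)) := by
    rw [lintegral_Ioi_eq_lintegral_Ioo hr0, ENNReal.ofReal_mul hc0.le, ← lintegral_beta
      hb0 (by positivity), ← lintegral_const_mul' _ _ ENNReal.ofReal_ne_top]
    refine setLIntegral_congr_fun measurableSet_Ioo fun s hs ↦ ?_
    have hs0 : 0 < s := hs.1
    have hs1 : 0 < 1 - s := by linarith [hs.2]
    have h1 : 0 < (1 - s) / s := by positivity
    have h2 : 1 + (((1 - s) / s) ^ (1 / r)) ^ r = s⁻¹ := by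
      rw [← Real.rpow_mul h1.le, one_div_mul_cancel hr0.ne', Real.rpow_one]; field_simp; ring
    rw [lintegral_Ioo_one_add_rpow hr0 (by positivity), h2,
      ENNReal.ofReal_rpow_of_nonneg (by positivity) hq.le, ← ENNReal.ofReal_mul (by positivity),
      ← ENNReal.ofReal_mul (by positivity), ← ENNReal.ofReal_mul hc0.le, hcr]
    congr 1
    rw [Real.mul_rpow (by positivity) (by positivity), Real.inv_rpow hs0.le,
      ← Real.rpow_neg hs0.le, ← Real.rpow_mul hs0.le, ← Real.rpow_mul h1.le, ← Real.rpow_mul h1.le,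
      one_div (s ^ 2), ← Real.rpow_natCast, ← Real.rpow_neg hs0.le]
    have h3 : ((1 - s) / s) ^ (c - 1) * (((1 - s) / s) ^ (c * q) *
        ((1 - s) / s) ^ (c * (-(q * (p - 1) / p) - 1))) = (1 - s) ^ c * s ^ (-c) := by
      rw [← Real.rpow_add h1, ← Real.rpow_add h1, Real.rpow_neg hs0.le, ← div_eq_mul_inv,
        ← Real.div_rpow hs1.le hs0.le]
      congr 1
      rw [hc]
      field_simp
      ring
    have h4 : s ^ (b - 1) = s ^ (-c) * s ^ (-((2 : ℕ) : ℝ)) * s ^ (-(-c) * q) := by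
      rw [← Real.rpow_add hs0, ← Real.rpow_add hs0]
      congr 1
      rw [hb, hc]
      push_cast
      field_simp
      ring
    rw [h4, add_sub_cancel_right]
    linear_combination c * s ^ (-((2 : ℕ) : ℝ)) * s ^ (-(-c) * q) * h3
  have hAB : 0 < c * ProbabilityTheory.beta (b + 1) c :=
    mul_pos hc0 (ProbabilityTheory.beta_pos (by positivity) hc0)
  have hZ := ProbabilityTheory.beta_pos hb0 (show 0 < c + 1 by positivity)
  refine ⟨fun t ↦ (1 + t ^ r) ^ (-(1 / r) - 1), by fun_prop, fun t ht ↦ by positivity, ?_, ?_, ?_⟩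
  · rw [hA]; simpa using hAB
  · rw [hA]; exact ENNReal.ofReal_ne_top
  rw [hA, hB, ENNReal.ofReal_rpow_of_nonneg (by positivity) (by positivity),
    ← ENNReal.ofReal_mul (blissConst_pos hp hpq).le]
  congr 1
  have hsymm : c * ProbabilityTheory.beta (b + 1) c = b * ProbabilityTheory.beta b (c + 1) := by
    rw [← mul_beta_add_one hb0 hc0]
    simp only [ProbabilityTheory.beta]
    rw [add_comm c (b + 1)]
    ring
  have hcq : q / (q - p) = c + 1 := by rw [hc]; field_simp; ring
  rw [hsymm, blissConst, ← hb, hcq, betaFn_eq_beta hb0 (by positivity)]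
  set Z := ProbabilityTheory.beta b (c + 1)
  set x := p / q with hx
  have hx0 : 0 < x := by positivity
  have hx1 : 0 < 1 - x := by rw [hx, sub_pos, div_lt_one hq]; exact hpq
  have e1 : b = (p - 1) / (1 - x) := by rw [hb, hx]; field_simp
  have e2 : c = x / (1 - x) := by rw [hc, hx]; field_simp
  rw [e1, e2, Real.mul_rpow (by positivity) hZ.le, Real.div_rpow hx0.le hx1.le,
    Real.rpow_neg hx0.le, Real.rpow_neg hx1.le]
  have h5 : (1 - x) ^ (1 - x) * (1 - x) ^ x = 1 - x := by
    rw [← Real.rpow_add hx1, sub_add_cancel, Real.rpow_one]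
  have h6 : Z ^ (1 - x) * Z ^ x = Z := by
    rw [← Real.rpow_add hZ, sub_add_cancel, Real.rpow_one]
  calc (p - 1) / (1 - x) * Z =
        (p - 1) / ((1 - x) ^ (1 - x) * (1 - x) ^ x) * (Z ^ (1 - x) * Z ^ x) := by rw [h5, h6]
    _ = _ := by field_simp

section Radial

variable {n : ℕ}

theorem omegaN_pos (hn : 1 ≤ n) : 0 < omegaN n := by
  have : (0 : ℝ) < n := by exact_mod_cast hn
  have := Real.Gamma_pos_of_pos (half_pos this)
  have := Real.pi_pos
  unfold omegaN
  positivity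

theorem volume_ball_euclideanSpace (hn : 1 ≤ n) {r : ℝ} (hr : 0 ≤ r) :
    volume (Metric.ball (0 : EuclideanSpace ℝ (Fin n)) r) =
      ENNReal.ofReal (omegaN n / n * r ^ n) := by
  have hn0 : (0 : ℝ) < n := by exact_mod_cast hn
  have : Nonempty (Fin n) := ⟨⟨0, hn⟩⟩
  have hΓ := Real.Gamma_pos_of_pos (half_pos hn0)
  rw [EuclideanSpace.volume_ball, ← ENNReal.ofReal_pow hr, ← ENNReal.ofReal_mul (by positivity),
    Fintype.card_fin, Real.Gamma_add_one (by positivity), omegaN, Real.sqrt_eq_rpow,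
    ← Real.rpow_natCast (Real.pi ^ (1 / 2 : ℝ)), ← Real.rpow_mul Real.pi_pos.le]
  congr 1
  rw [show (1 / 2 : ℝ) * n = n / 2 by ring]
  field_simp

theorem toSphere_univ_euclideanSpace (hn : 1 ≤ n) :
    (volume : Measure (EuclideanSpace ℝ (Fin n))).toSphere univ = ENNReal.ofReal (omegaN n) := by
  have hn0 : (0 : ℝ) < n := by exact_mod_cast hn
  rw [Measure.toSphere_apply_univ, volume_ball_euclideanSpace hn zero_le_one,
    finrank_euclideanSpace_fin, ← ENNReal.ofReal_natCast, ← ENNReal.ofReal_mul hn0.le]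
  congr 1
  field_simp
  simp

/-- The kernel of the fractional Hardy operator on `ℝⁿ`. -/
noncomputable def hardyKernel (n : ℕ) (β : ℝ) (x y : EuclideanSpace ℝ (Fin n)) : ℝ≥0∞ :=
  volume (Metric.ball (0 : EuclideanSpace ℝ (Fin n)) ‖x‖) ^ (β / n - 1) *
    {z : EuclideanSpace ℝ (Fin n) | ‖z‖ < ‖x‖}.indicator 1 y

theorem measurable_hardyKernel (hn : 1 ≤ n) (β : ℝ) :
    Measurable (Function.uncurry (hardyKernel n β)) := by
  have h1 : ∀ x : EuclideanSpace ℝ (Fin n), volume (Metric.ball (0 : EuclideanSpace ℝ (Fin n)) ‖x‖)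
      = ENNReal.ofReal (omegaN n / n * ‖x‖ ^ n) := fun x ↦
    volume_ball_euclideanSpace hn (norm_nonneg x)
  have h2 : Function.uncurry (hardyKernel n β) = fun z ↦
      ENNReal.ofReal (omegaN n / n * ‖z.1‖ ^ n) ^ (β / n - 1) *
        {z : EuclideanSpace ℝ (Fin n) × EuclideanSpace ℝ (Fin n) | ‖z.2‖ < ‖z.1‖}.indicator 1 z := by
    ext z
    simp only [Function.uncurry, hardyKernel, h1]
    rfl
  rw [h2]
  refine Measurable.mul (by fun_prop) (measurable_one.indicator ?_)
  exact measurableSet_lt measurable_snd.norm measurable_fst.norm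

/-- The density, in the variable `t = ‖x‖ ^ a`, of the integral of `f` over balls. -/
noncomputable def radialDensity (a : ℝ) (f : EuclideanSpace ℝ (Fin n) → ℝ≥0∞) (t : ℝ) : ℝ≥0∞ :=
  ENNReal.ofReal (1 / a * t ^ ((n : ℝ) / a - 1)) *
    ∫⁻ θ : Metric.sphere (0 : EuclideanSpace ℝ (Fin n)) 1,
      f (t ^ (1 / a) • (θ : EuclideanSpace ℝ (Fin n)))
        ∂(volume : Measure (EuclideanSpace ℝ (Fin n))).toSphere

theorem measurable_radialDensity (a : ℝ) {f : EuclideanSpace ℝ (Fin n) → ℝ≥0∞}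
    (hf : Measurable f) : Measurable (radialDensity a f) := by
  have hm : Measurable fun z : ℝ × Metric.sphere (0 : EuclideanSpace ℝ (Fin n)) 1 ↦
      f (z.1 ^ (1 / a) • (z.2 : EuclideanSpace ℝ (Fin n))) :=
    hf.comp ((measurable_fst.pow_const _).smul (measurable_subtype_coe.comp measurable_snd))
  exact Measurable.mul (by fun_prop) hm.lintegral_prod_right'

theorem lintegral_eq_lintegral_radialDensity (hn : 1 ≤ n) {a : ℝ} (ha : 0 < a)
    {f : EuclideanSpace ℝ (Fin n) → ℝ≥0∞} (hf : Measurable f) :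
    ∫⁻ x, f x = ∫⁻ t in Ioi (0 : ℝ), radialDensity a f t := by
  have : Nontrivial (EuclideanSpace ℝ (Fin n)) :=
    Module.nontrivial_of_finrank_pos (R := ℝ) (by rw [finrank_euclideanSpace_fin]; exact hn)
  rw [lintegral_eq_lintegral_Ioi_rpow_toSphere volume ha hf, finrank_euclideanSpace_fin]
  rfl

theorem norm_rpow_smul_sphere {t : ℝ} (ht : 0 ≤ t) (c : ℝ)
    (θ : Metric.sphere (0 : EuclideanSpace ℝ (Fin n)) 1) :
    ‖t ^ c • (θ : EuclideanSpace ℝ (Fin n))‖ = t ^ c := by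
  rw [norm_smul, norm_eq_of_mem_sphere θ, mul_one, Real.norm_of_nonneg (Real.rpow_nonneg ht _)]

theorem lintegral_hardyKernel_mul (hn : 1 ≤ n) (β : ℝ) {a : ℝ} (ha : 0 < a)
    {f : EuclideanSpace ℝ (Fin n) → ℝ≥0∞} (hf : Measurable f) {t : ℝ} (ht : 0 < t)
    {x : EuclideanSpace ℝ (Fin n)} (hx : ‖x‖ = t ^ (1 / a)) :
    ∫⁻ y, hardyKernel n β x y * f y =
      ENNReal.ofReal ((omegaN n / n * t ^ ((n : ℝ) / a)) ^ (β / n - 1)) *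
        ∫⁻ s in Ioo 0 t, radialDensity a f s := by
  have hn0 : (0 : ℝ) < n := by exact_mod_cast hn
  have hω := omegaN_pos hn
  have hS : MeasurableSet {z : EuclideanSpace ℝ (Fin n) | ‖z‖ < ‖x‖} :=
    measurableSet_lt measurable_norm measurable_const
  have hg := hf.indicator hS
  have hK : ∀ y, hardyKernel n β x y * f y =
      ENNReal.ofReal ((omegaN n / n * t ^ ((n : ℝ) / a)) ^ (β / n - 1)) *
        {z : EuclideanSpace ℝ (Fin n) | ‖z‖ < ‖x‖}.indicator f y := by
    intro y
    rw [hardyKernel, volume_ball_euclideanSpace hn (norm_nonneg x), hx, ← Real.rpow_natCast,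
      ← Real.rpow_mul ht.le, one_div_mul_eq_div,
      ENNReal.ofReal_rpow_of_pos (by positivity), mul_assoc]
    congr 1
    by_cases hy : y ∈ {z : EuclideanSpace ℝ (Fin n) | ‖z‖ < t ^ (1 / a)}
    · rw [indicator_of_mem hy, indicator_of_mem hy, Pi.one_apply, one_mul]
    · rw [indicator_of_notMem hy, indicator_of_notMem hy, zero_mul]
  simp_rw [hK]
  rw [lintegral_const_mul _ hg, lintegral_eq_lintegral_radialDensity hn ha hg,
    ← lintegral_indicator measurableSet_Ioi, ← lintegral_indicator measurableSet_Ioo]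
  congr 1
  refine lintegral_congr fun s ↦ ?_
  by_cases hs : 0 < s
  · rw [indicator_of_mem (mem_Ioi.2 hs)]
    by_cases hst : s < t
    · rw [indicator_of_mem (mem_Ioo.2 ⟨hs, hst⟩), radialDensity, radialDensity]
      congr 1
      refine lintegral_congr fun θ ↦ indicator_of_mem ?_ _
      change ‖s ^ (1 / a) • (θ : EuclideanSpace ℝ (Fin n))‖ < ‖x‖
      rw [norm_rpow_smul_sphere hs.le, hx]
      exact Real.rpow_lt_rpow hs.le hst (by positivity)
    · rw [indicator_of_notMem (show s ∉ Ioo 0 t from fun h ↦ hst h.2), radialDensity]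
      have : ∀ θ : Metric.sphere (0 : EuclideanSpace ℝ (Fin n)) 1,
          {z : EuclideanSpace ℝ (Fin n) | ‖z‖ < ‖x‖}.indicator f
            (s ^ (1 / a) • (θ : EuclideanSpace ℝ (Fin n))) = 0 := by
        refine fun θ ↦ indicator_of_notMem ?_ _
        change ¬ ‖s ^ (1 / a) • (θ : EuclideanSpace ℝ (Fin n))‖ < ‖x‖
        rw [norm_rpow_smul_sphere hs.le, hx, not_lt]
        exact Real.rpow_le_rpow ht.le (not_lt.1 hst) (by positivity)
      rw [lintegral_congr this, lintegral_zero, mul_zero]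
  · rw [indicator_of_notMem (show s ∉ Ioi (0 : ℝ) from hs),
      indicator_of_notMem (show s ∉ Ioo 0 t from fun h ↦ hs h.1)]

theorem lintegral_hardy_rpow (hn : 1 ≤ n) (α β : ℝ) {a q : ℝ} (ha : 0 < a) (hq : 0 < q)
    {f : EuclideanSpace ℝ (Fin n) → ℝ≥0∞} (hf : Measurable f) :
    ∫⁻ x, (∫⁻ y, hardyKernel n β x y * f y) ^ q * ENNReal.ofReal (‖x‖ ^ α) =
      ENNReal.ofReal (omegaN n * (omegaN n / n) ^ ((β / n - 1) * q) * (1 / a)) *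
        ∫⁻ t in Ioi (0 : ℝ), (∫⁻ s in Ioo 0 t, radialDensity a f s) ^ q *
          ENNReal.ofReal (t ^ ((n + α + (β - n) * q) / a - 1)) := by
  have hn0 : (0 : ℝ) < n := by exact_mod_cast hn
  have hω := omegaN_pos hn
  have hm : Measurable fun x ↦ (∫⁻ y, hardyKernel n β x y * f y) ^ q *
      ENNReal.ofReal (‖x‖ ^ α) :=
    (((measurable_hardyKernel hn β).mul (hf.comp measurable_snd)).lintegral_prod_right'.pow_const
      q).mul (by fun_prop)
  rw [lintegral_eq_lintegral_radialDensity hn ha hm, ← lintegral_const_mul' _ _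
    ENNReal.ofReal_ne_top]
  refine setLIntegral_congr_fun measurableSet_Ioi fun t ht ↦ ?_
  have ht0 : 0 < t := ht
  have h1 : ∀ θ : Metric.sphere (0 : EuclideanSpace ℝ (Fin n)) 1,
      (∫⁻ y, hardyKernel n β (t ^ (1 / a) • (θ : EuclideanSpace ℝ (Fin n))) y * f y) ^ q *
        ENNReal.ofReal (‖t ^ (1 / a) • (θ : EuclideanSpace ℝ (Fin n))‖ ^ α) =
      (ENNReal.ofReal ((omegaN n / n * t ^ ((n : ℝ) / a)) ^ (β / n - 1)) *
        ∫⁻ s in Ioo 0 t, radialDensity a f s) ^ q * ENNReal.ofReal ((t ^ (1 / a)) ^ α) := by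
    intro θ
    rw [lintegral_hardyKernel_mul hn β ha hf ht0 (norm_rpow_smul_sphere ht0.le _ θ),
      norm_rpow_smul_sphere ht0.le]
  simp only [radialDensity, h1]
  rw [lintegral_const, toSphere_univ_euclideanSpace hn, ENNReal.mul_rpow_of_nonneg _ _ hq.le,
    ENNReal.ofReal_rpow_of_nonneg (by positivity) hq.le]
  have e : omegaN n * (omegaN n / n) ^ ((β / n - 1) * q) * (1 / a) *
        t ^ ((n + α + (β - n) * q) / a - 1) =
      1 / a * t ^ ((n : ℝ) / a - 1) * (((omegaN n / n * t ^ ((n : ℝ) / a)) ^ (β / n - 1)) ^ q) *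
        (t ^ (1 / a)) ^ α * omegaN n := by
    rw [← Real.rpow_mul (by positivity), Real.mul_rpow (by positivity) (by positivity),
      ← Real.rpow_mul ht0.le, ← Real.rpow_mul ht0.le]
    have : t ^ ((n + α + (β - n) * q) / a - 1) = t ^ ((n : ℝ) / a - 1) *
        t ^ ((n : ℝ) / a * ((β / n - 1) * q)) * t ^ (1 / a * α) := by
      rw [← Real.rpow_add ht0, ← Real.rpow_add ht0]
      congr 1
      field_simp
      ring
    rw [this]
    ring
  set W := (∫⁻ s in Ioo 0 t, radialDensity a f s) ^ q with hW
  change _ * (_ * W * _ * _) = _ * (W * _)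
  rw [mul_left_comm _ W, ← ENNReal.ofReal_mul (by positivity), e]
  repeat rw [ENNReal.ofReal_mul (by positivity)]
  ring

theorem lintegral_rpow_mul_norm (hn : 1 ≤ n) {a p γ : ℝ} (ha : 0 < a) (hp : 1 < p)
    (hγ : a * (p - 1) = n * (p - 1) - γ)
    {f : EuclideanSpace ℝ (Fin n) → ℝ≥0∞} (hf : Measurable f) :
    ∫⁻ x, f x ^ p * ENNReal.ofReal (‖x‖ ^ γ) =
      ENNReal.ofReal (a ^ (p - 1) * omegaN n ^ (1 - p)) * ∫⁻ t in Ioi (0 : ℝ),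
        ENNReal.ofReal (1 / a * t ^ ((n : ℝ) / a - 1)) ^ p * (ENNReal.ofReal (omegaN n) ^ (p - 1) *
          ∫⁻ θ : Metric.sphere (0 : EuclideanSpace ℝ (Fin n)) 1,
            f (t ^ (1 / a) • (θ : EuclideanSpace ℝ (Fin n))) ^ p
              ∂(volume : Measure (EuclideanSpace ℝ (Fin n))).toSphere) := by
  have hω := omegaN_pos hn
  have hm : Measurable fun x ↦ f x ^ p * ENNReal.ofReal (‖x‖ ^ γ) :=
    (hf.pow_const p).mul (by fun_prop)
  rw [lintegral_eq_lintegral_radialDensity hn ha hm, ← lintegral_const_mul' _ _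
    ENNReal.ofReal_ne_top]
  refine setLIntegral_congr_fun measurableSet_Ioi fun t ht ↦ ?_
  have ht0 : 0 < t := ht
  simp only [radialDensity, norm_rpow_smul_sphere ht0.le]
  rw [lintegral_mul_const' _ _ ENNReal.ofReal_ne_top,
    ENNReal.ofReal_rpow_of_nonneg (by positivity) (by linarith), ENNReal.ofReal_rpow_of_pos hω,
    mul_comm (∫⁻ θ, _ ∂_), ← mul_assoc, ← mul_assoc, ← mul_assoc,
    ← ENNReal.ofReal_mul (by positivity), ← ENNReal.ofReal_mul (by positivity),
    ← ENNReal.ofReal_mul (by positivity)]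
  congr 2
  rw [Real.mul_rpow (by positivity) (by positivity), ← Real.rpow_mul ht0.le, ← Real.rpow_mul ht0.le,
    one_div, Real.inv_rpow ha.le, Real.rpow_sub_one ha.ne', mul_assoc, ← Real.rpow_add ht0]
  have e1 : omegaN n ^ (1 - p) * omegaN n ^ (p - 1) = 1 := by
    rw [← Real.rpow_add hω]; simp
  have e2 : (n : ℝ) / a - 1 + a⁻¹ * γ = ((n : ℝ) / a - 1) * p := by
    have : γ = n * (p - 1) - a * (p - 1) := by linarith
    rw [this]
    field_simp
    ring
  have e3 : 0 < a ^ p := by positivity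
  rw [e2]
  calc a⁻¹ * t ^ (((n : ℝ) / a - 1) * p) =
      (omegaN n ^ (1 - p) * omegaN n ^ (p - 1)) * (a ^ p / a * (a ^ p)⁻¹) *
        t ^ (((n : ℝ) / a - 1) * p) := by rw [e1]; field_simp
    _ = _ := by ring

theorem lintegral_radialDensity_rpow_le (hn : 1 ≤ n) {a p γ : ℝ} (ha : 0 < a) (hp : 1 < p)
    (hγ : a * (p - 1) = n * (p - 1) - γ)
    {f : EuclideanSpace ℝ (Fin n) → ℝ≥0∞} (hf : Measurable f) :
    ENNReal.ofReal (a ^ (p - 1) * omegaN n ^ (1 - p)) *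
        ∫⁻ t in Ioi (0 : ℝ), radialDensity a f t ^ p ≤
      ∫⁻ x, f x ^ p * ENNReal.ofReal (‖x‖ ^ γ) := by
  have hp0 : 0 < p := by linarith
  rw [lintegral_rpow_mul_norm hn ha hp hγ hf]
  gcongr with t
  rw [radialDensity, ENNReal.mul_rpow_of_nonneg _ _ hp0.le]
  gcongr
  have hft : Measurable fun θ : Metric.sphere (0 : EuclideanSpace ℝ (Fin n)) 1 ↦
      f (t ^ (1 / a) • (θ : EuclideanSpace ℝ (Fin n))) :=
    hf.comp (g := f) (f := fun θ : Metric.sphere (0 : EuclideanSpace ℝ (Fin n)) 1 ↦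
      t ^ (1 / a) • (θ : EuclideanSpace ℝ (Fin n))) (by fun_prop)
  have hc : p.HolderConjugate (Real.conjExponent p) := Real.HolderConjugate.conjExponent hp
  have h := ENNReal.lintegral_mul_le_Lp_mul_Lq
    (volume : Measure (EuclideanSpace ℝ (Fin n))).toSphere hc hft.aemeasurable
    (aemeasurable_const (b := (1 : ℝ≥0∞)))
  simp only [Pi.mul_apply, mul_one, ENNReal.one_rpow, lintegral_one] at h
  rw [toSphere_univ_euclideanSpace hn] at h
  calc _ ≤ ((∫⁻ θ : Metric.sphere (0 : EuclideanSpace ℝ (Fin n)) 1,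
        f (t ^ (1 / a) • (θ : EuclideanSpace ℝ (Fin n))) ^ p
          ∂(volume : Measure (EuclideanSpace ℝ (Fin n))).toSphere) ^ (1 / p) *
        ENNReal.ofReal (omegaN n) ^ (1 / Real.conjExponent p)) ^ p :=
        ENNReal.rpow_le_rpow h hp0.le
    _ = _ := by
        rw [ENNReal.mul_rpow_of_nonneg _ _ hp0.le, ← ENNReal.rpow_mul, ← ENNReal.rpow_mul,
          one_div_mul_cancel hp0.ne', ENNReal.rpow_one, mul_comm]
        congr 2
        have : 0 < p - 1 := by linarith
        rw [Real.conjExponent]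
        field_simp

theorem lintegral_radialDensity_rpow_eq (hn : 1 ≤ n) {a p γ : ℝ} (ha : 0 < a) (hp : 1 < p)
    (hγ : a * (p - 1) = n * (p - 1) - γ) {φ : ℝ → ℝ≥0∞} (hφ : Measurable φ) :
    ENNReal.ofReal (a ^ (p - 1) * omegaN n ^ (1 - p)) * ∫⁻ t in Ioi (0 : ℝ),
        radialDensity a (fun x : EuclideanSpace ℝ (Fin n) ↦ φ ‖x‖) t ^ p =
      ∫⁻ x : EuclideanSpace ℝ (Fin n), φ ‖x‖ ^ p * ENNReal.ofReal (‖x‖ ^ γ) := by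
  have hp0 : 0 < p := by linarith
  have hω := omegaN_pos hn
  rw [lintegral_rpow_mul_norm hn ha hp hγ (f := fun x ↦ φ ‖x‖) (hφ.comp measurable_norm)]
  congr 1
  refine setLIntegral_congr_fun measurableSet_Ioi fun t ht ↦ ?_
  simp only [radialDensity, norm_rpow_smul_sphere (le_of_lt ht), lintegral_const,
    toSphere_univ_euclideanSpace hn]
  rw [ENNReal.mul_rpow_of_nonneg _ _ hp0.le, ENNReal.mul_rpow_of_nonneg _ _ hp0.le,
    mul_left_comm (ENNReal.ofReal (omegaN n) ^ (p - 1))]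
  congr 2
  have h0 : ENNReal.ofReal (omegaN n) ≠ 0 := by simpa using hω
  nth_rewrite 3 [← ENNReal.rpow_one (ENNReal.ofReal (omegaN n))]
  rw [← ENNReal.rpow_add _ _ h0 ENNReal.ofReal_ne_top, sub_add_cancel]

end Radial

section SingleFactor

theorem scaling_identity {w N a κ : ℝ} (hw : 0 < w) (hN : 0 < N) (ha : 0 < a) (hκ : 0 < κ)
    {p q : ℝ} (hp : p ≠ 0) (hq : q ≠ 0) (b : ℝ) :
    (w * (w / N) ^ ((b - 1) * q) * (1 / a)) ^ (1 / q) =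
      w ^ (1 / q - 1 / p + b) * N ^ (1 / p - 1 / q - b) * (N / a) ^ ((1 - 1 / p) + 1 / q) *
        κ ^ (-(1 / p)) * (a ^ (p - 1) * w ^ (1 - p) * κ) ^ (1 / p) := by
  obtain ⟨w, rfl⟩ : ∃ s, Real.exp s = w := ⟨_, Real.exp_log hw⟩
  obtain ⟨N, rfl⟩ : ∃ s, Real.exp s = N := ⟨_, Real.exp_log hN⟩
  obtain ⟨a, rfl⟩ : ∃ s, Real.exp s = a := ⟨_, Real.exp_log ha⟩
  obtain ⟨κ, rfl⟩ : ∃ s, Real.exp s = κ := ⟨_, Real.exp_log hκ⟩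
  simp only [one_div, ← Real.exp_neg, ← Real.exp_sub, ← Real.exp_mul, ← Real.exp_add]
  congr 1
  field_simp
  ring

/-- The sharp constant of the fractional Hardy operator on `ℝⁿ`. -/
noncomputable def hardyConst (n : ℕ) (β γ p q : ℝ) : ℝ :=
  (omegaN n) ^ (1 / q - 1 / p + β / n) *
    (n : ℝ) ^ (1 / p - 1 / q - β / n) *
    ((n * (p - 1)) / (n * (p - 1) - γ)) ^ ((1 - 1 / p) + 1 / q) *
    ((p / (p - 1)) / q) ^ (1 / q) *
    ((p / (q - p)) *
      betaFn (p / (q - p)) (p * q / ((q / (q - 1)) * (q - p)))) ^ (1 / q - 1 / p)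

variable {n : ℕ} {p q α β γ : ℝ}

theorem hardyConst_eq (hp : 1 < p) (hpq : p < q) {a : ℝ} (hγ : a * (p - 1) = n * (p - 1) - γ) :
    hardyConst n β γ p q = omegaN n ^ (1 / q - 1 / p + β / n) *
      (n : ℝ) ^ (1 / p - 1 / q - β / n) * (n / a) ^ ((1 - 1 / p) + 1 / q) *
      blissConst p q ^ (-(1 / p)) := by
  rw [blissConst_rpow_neg hp hpq, hardyConst, ← hγ,
    mul_div_mul_right _ _ (sub_pos.2 hp).ne']
  ring

theorem hardyConst_nonneg (hn : 1 ≤ n) (hp : 1 < p) (hpq : p < q) (hγ : γ < n * (p - 1)) :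
    0 ≤ hardyConst n β γ p q := by
  have hp1 : 0 < p - 1 := by linarith
  have ha : 0 < (n * (p - 1) - γ) / (p - 1) := div_pos (by linarith) hp1
  have hω := omegaN_pos hn
  have hκ := blissConst_pos hp hpq
  rw [hardyConst_eq hp hpq (div_mul_cancel₀ _ hp1.ne')]
  positivity

theorem lintegral_hardy_rpow_eq (hn : 1 ≤ n) (hp : 1 < p) (hpq : p < q) {a : ℝ} (ha : 0 < a)
    (hγ : a * (p - 1) = n * (p - 1) - γ) (hscal : β + (α + n) / q = (γ + n) / p)
    {f : EuclideanSpace ℝ (Fin n) → ℝ≥0∞} (hf : Measurable f) :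
    (∫⁻ x, (∫⁻ y, hardyKernel n β x y * f y) ^ q * ENNReal.ofReal (‖x‖ ^ α)) ^ (1 / q) =
      ENNReal.ofReal (hardyConst n β γ p q) *
        (ENNReal.ofReal (a ^ (p - 1) * omegaN n ^ (1 - p)) * (ENNReal.ofReal (blissConst p q) *
          (∫⁻ t in Ioi 0, (∫⁻ s in Ioo 0 t, radialDensity a f s) ^ q *
            ENNReal.ofReal (t ^ (-(q * (p - 1) / p) - 1))) ^ (p / q))) ^ (1 / p) := by
  have hp0 : 0 < p := by linarith
  have hq : 0 < q := by linarith
  have hn0 : (0 : ℝ) < n := by exact_mod_cast hn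
  have hω := omegaN_pos hn
  have hκ := blissConst_pos hp hpq
  have hexp : (n + α + (β - n) * q) / a - 1 = -(q * (p - 1) / p) - 1 := by
    have h1 : α = q * ((γ + n) / p - β) - n := by
      rw [← hscal]
      field_simp
      ring
    have h2 : γ = n * (p - 1) - a * (p - 1) := by linarith
    rw [h1, h2]
    field_simp
    ring
  rw [lintegral_hardy_rpow hn α β ha hq hf, hexp, ENNReal.mul_rpow_of_nonneg _ _ (by positivity),
    ENNReal.ofReal_rpow_of_nonneg (by positivity) (by positivity),
    scaling_identity hω hn0 ha hκ hp0.ne' hq.ne', ← hardyConst_eq hp hpq hγ, ← mul_assoc,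
    ENNReal.mul_rpow_of_nonneg _ _ (by positivity : 0 ≤ 1 / p), ← ENNReal.rpow_mul,
    ← ENNReal.ofReal_mul (by positivity), ENNReal.ofReal_mul' (by positivity),
    ENNReal.ofReal_rpow_of_nonneg (by positivity) (by positivity), ← mul_assoc]
  congr 2
  field_simp

theorem kernelBound_hardyKernel (hn : 1 ≤ n) (hp : 1 < p) (hpq : p < q) (hγ : γ < n * (p - 1))
    (hscal : β + (α + n) / q = (γ + n) / p) :
    KernelBound (hardyKernel n β) (fun x ↦ ENNReal.ofReal (‖x‖ ^ α))
      (fun x ↦ ENNReal.ofReal (‖x‖ ^ γ)) p q (ENNReal.ofReal (hardyConst n β γ p q)) := by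
  intro f hf
  have hp0 : 0 < p := by linarith
  have hp1 : 0 < p - 1 := by linarith
  have ha : 0 < (n * (p - 1) - γ) / (p - 1) := div_pos (by linarith) hp1
  have hγa := div_mul_cancel₀ (n * (p - 1) - γ) hp1.ne'
  rw [lintegral_hardy_rpow_eq hn hp hpq ha hγa hscal hf]
  gcongr
  refine le_trans ?_ (lintegral_radialDensity_rpow_le hn ha hp hγa hf)
  gcongr
  exact bliss hp hpq (measurable_radialDensity _ hf)

theorem exists_hardyKernel_eq (hn : 1 ≤ n) (hp : 1 < p) (hpq : p < q) (hγ : γ < n * (p - 1))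
    (hscal : β + (α + n) / q = (γ + n) / p) :
    ∃ f : EuclideanSpace ℝ (Fin n) → ℝ≥0∞, Measurable f ∧
      ∫⁻ x, f x ^ p * ENNReal.ofReal (‖x‖ ^ γ) ≠ 0 ∧
      ∫⁻ x, f x ^ p * ENNReal.ofReal (‖x‖ ^ γ) ≠ ∞ ∧
      (∫⁻ x, (∫⁻ y, hardyKernel n β x y * f y) ^ q * ENNReal.ofReal (‖x‖ ^ α)) ^ (1 / q) =
        ENNReal.ofReal (hardyConst n β γ p q) *
          (∫⁻ x, f x ^ p * ENNReal.ofReal (‖x‖ ^ γ)) ^ (1 / p) := by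
  have hp0 : 0 < p := by linarith
  have hp1 : 0 < p - 1 := by linarith
  have hω := omegaN_pos hn
  have hγa := div_mul_cancel₀ (n * (p - 1) - γ) hp1.ne'
  have ha : 0 < (n * (p - 1) - γ) / (p - 1) := div_pos (by linarith) hp1
  set a := (n * (p - 1) - γ) / (p - 1)
  obtain ⟨H, hHm, hHpos, h0, htop, heq⟩ := exists_bliss_eq hp hpq
  set φ : ℝ → ℝ≥0∞ := fun r ↦
    ENNReal.ofReal (a / omegaN n * (r ^ a) ^ (1 - n / a) * H (r ^ a)) with hφ
  have hφm : Measurable φ := by fun_prop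
  have hfm : Measurable fun x : EuclideanSpace ℝ (Fin n) ↦ φ ‖x‖ := hφm.comp measurable_norm
  have hD : ∀ t, 0 < t →
      radialDensity a (fun x : EuclideanSpace ℝ (Fin n) ↦ φ ‖x‖) t = ENNReal.ofReal (H t) := by
    intro t ht
    have hHt := hHpos t ht
    have e : t ^ ((n : ℝ) / a - 1) * t ^ (1 - (n : ℝ) / a) = 1 := by
      rw [← Real.rpow_add ht]
      simp
    simp only [radialDensity, norm_rpow_smul_sphere ht.le, lintegral_const,
      toSphere_univ_euclideanSpace hn, hφ]
    rw [← Real.rpow_mul ht.le, one_div_mul_cancel ha.ne', Real.rpow_one,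
      ← ENNReal.ofReal_mul (by positivity), ← ENNReal.ofReal_mul (by positivity)]
    congr 1
    calc _ = (t ^ ((n : ℝ) / a - 1) * t ^ (1 - (n : ℝ) / a)) * H t := by field_simp
      _ = H t := by rw [e, one_mul]
  have hc0 : ENNReal.ofReal (a ^ (p - 1) * omegaN n ^ (1 - p)) ≠ 0 := by
    rw [Ne, ENNReal.ofReal_eq_zero, not_le]
    positivity
  have hDp : ∫⁻ t in Ioi 0, radialDensity a (fun x : EuclideanSpace ℝ (Fin n) ↦ φ ‖x‖) t ^ p =
      ∫⁻ t in Ioi 0, ENNReal.ofReal (H t) ^ p :=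
    setLIntegral_congr_fun measurableSet_Ioi fun t ht ↦ by simp only [hD t ht]
  have hDi : ∀ t, ∫⁻ s in Ioo 0 t, radialDensity a (fun x : EuclideanSpace ℝ (Fin n) ↦ φ ‖x‖) s =
      ∫⁻ s in Ioo 0 t, ENNReal.ofReal (H s) := fun t ↦
    setLIntegral_congr_fun measurableSet_Ioo fun s hs ↦ hD s hs.1
  refine ⟨_, hfm, ?_, ?_, ?_⟩
  · rw [← lintegral_radialDensity_rpow_eq hn ha hp hγa hφm, hDp]
    exact mul_ne_zero hc0 h0
  · rw [← lintegral_radialDensity_rpow_eq hn ha hp hγa hφm, hDp]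
    exact ENNReal.mul_ne_top ENNReal.ofReal_ne_top htop
  · rw [lintegral_hardy_rpow_eq hn hp hpq ha hγa hscal hfm,
      ← lintegral_radialDensity_rpow_eq hn ha hp hγa hφm, hDp, heq]
    simp only [hDi]

end SingleFactor

section Product

variable {m : ℕ} {n : Fin m → ℕ}

theorem prod_hardyKernel (β : Fin m → ℝ) (x y : ∀ i, EuclideanSpace ℝ (Fin (n i))) :
    ∏ i, hardyKernel (n i) (β i) (x i) (y i) =
      (∏ i, volume (Metric.ball (0 : EuclideanSpace ℝ (Fin (n i))) ‖x i‖) ^ (β i / n i - 1)) *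
        {z : ∀ i, EuclideanSpace ℝ (Fin (n i)) | ∀ i, ‖z i‖ < ‖x i‖}.indicator 1 y := by
  simp only [hardyKernel, Finset.prod_mul_distrib]
  congr 1
  by_cases hy : ∀ i, ‖y i‖ < ‖x i‖
  · rw [indicator_of_mem (show y ∈ {z | ∀ i, ‖z i‖ < ‖x i‖} from hy)]
    exact Finset.prod_eq_one fun i _ ↦ indicator_of_mem (show y i ∈ {z | ‖z‖ < ‖x i‖} from hy i) _
  · rw [indicator_of_notMem (show y ∉ {z | ∀ i, ‖z i‖ < ‖x i‖} from hy)]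
    obtain ⟨i, hi⟩ := not_forall.1 hy
    exact Finset.prod_eq_zero (Finset.mem_univ i)
      (indicator_of_notMem (show y i ∉ {z | ‖z‖ < ‖x i‖} from hi) _)

theorem prodFracHardy_eq_lintegral (β : Fin m → ℝ)
    {f : (∀ i, EuclideanSpace ℝ (Fin (n i))) → ℝ≥0∞} (hf : Measurable f)
    (x : ∀ i, EuclideanSpace ℝ (Fin (n i))) :
    prodFracHardy m n β f x =
      ∫⁻ y, (∏ i, hardyKernel (n i) (β i) (x i) (y i)) * f y := by
  have hS : MeasurableSet {z : ∀ i, EuclideanSpace ℝ (Fin (n i)) | ∀ i, ‖z i‖ < ‖x i‖} := by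
    rw [ofPred_forall]
    exact MeasurableSet.iInter fun i ↦
      measurableSet_lt (measurable_pi_apply i).norm measurable_const
  have h (y : ∀ i, EuclideanSpace ℝ (Fin (n i))) :
      (∏ i, hardyKernel (n i) (β i) (x i) (y i)) * f y =
      (∏ i, volume (Metric.ball (0 : EuclideanSpace ℝ (Fin (n i))) ‖x i‖) ^ (β i / n i - 1)) *
        {z : ∀ i, EuclideanSpace ℝ (Fin (n i)) | ∀ i, ‖z i‖ < ‖x i‖}.indicator f y := by
    rw [prod_hardyKernel, mul_assoc]
    congr 1
    by_cases hy : y ∈ {z : ∀ i, EuclideanSpace ℝ (Fin (n i)) | ∀ i, ‖z i‖ < ‖x i‖}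
    · rw [indicator_of_mem hy, indicator_of_mem hy, Pi.one_apply, one_mul]
    · rw [indicator_of_notMem hy, indicator_of_notMem hy, zero_mul]
  rw [lintegral_congr h, lintegral_const_mul _ (hf.indicator hS), lintegral_indicator hS,
    prodFracHardy]

theorem ofReal_prod_norm_rpow (a : Fin m → ℝ) (x : ∀ i, EuclideanSpace ℝ (Fin (n i))) :
    ENNReal.ofReal (∏ i, ‖x i‖ ^ a i) = ∏ i, ENNReal.ofReal (‖x i‖ ^ a i) :=
  ENNReal.ofReal_prod_of_nonneg fun _ _ ↦ by positivity

end Product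

/-- Sharp weighted bound for `𝓗_{β₁,…,β_m} : L^p(|x|^γ) → L^q(|x|^α)`. -/
theorem weighted_prodFracHardy_sharp (m : ℕ) (hm : 1 ≤ m) (n : Fin m → ℕ)
    (hn : ∀ i, 1 ≤ n i) (β α γ : Fin m → ℝ) (p q : ℝ) (hp : 1 < p) (hpq : p < q)
    (hβ0 : ∀ i, 0 ≤ β i) (hβn : ∀ i, β i < n i) (hγ : ∀ i, γ i < n i * (p - 1))
    (hscal : ∀ i, β i + (α i + n i) / q = (γ i + n i) / p) :
    (∀ f : (∀ i, EuclideanSpace ℝ (Fin (n i))) → ℝ≥0∞, Measurable f →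
      (∫⁻ x, prodFracHardy m n β f x ^ q * ENNReal.ofReal (∏ i, ‖x i‖ ^ α i)) ^ (1 / q)
        ≤ ENNReal.ofReal (∏ i,
            (omegaN (n i)) ^ (1 / q - 1 / p + β i / n i) *
              (n i : ℝ) ^ (1 / p - 1 / q - β i / n i) *
              ((n i * (p - 1)) / (n i * (p - 1) - γ i)) ^ ((1 - 1 / p) + 1 / q) *
              ((p / (p - 1)) / q) ^ (1 / q) *
              ((p / (q - p)) *
                betaFn (p / (q - p)) (p * q / ((q / (q - 1)) * (q - p)))) ^ (1 / q - 1 / p)) *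
          (∫⁻ x, f x ^ p * ENNReal.ofReal (∏ i, ‖x i‖ ^ γ i)) ^ (1 / p)) ∧
    (∀ C : ℝ≥0∞,
      (∀ f : (∀ i, EuclideanSpace ℝ (Fin (n i))) → ℝ≥0∞, Measurable f →
        (∫⁻ x, prodFracHardy m n β f x ^ q * ENNReal.ofReal (∏ i, ‖x i‖ ^ α i)) ^ (1 / q)
          ≤ C * (∫⁻ x, f x ^ p * ENNReal.ofReal (∏ i, ‖x i‖ ^ γ i)) ^ (1 / p)) →
      ENNReal.ofReal (∏ i,
          (omegaN (n i)) ^ (1 / q - 1 / p + β i / n i) *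
            (n i : ℝ) ^ (1 / p - 1 / q - β i / n i) *
            ((n i * (p - 1)) / (n i * (p - 1) - γ i)) ^ ((1 - 1 / p) + 1 / q) *
            ((p / (p - 1)) / q) ^ (1 / q) *
            ((p / (q - p)) *
              betaFn (p / (q - p)) (p * q / ((q / (q - 1)) * (q - p)))) ^ (1 / q - 1 / p)) ≤ C) := by
  have hp0 : 0 < p := by linarith
  have hq : 0 < q := by linarith
  simp only [← hardyConst.eq_1]
  rw [ENNReal.ofReal_prod_of_nonneg fun i _ ↦ hardyConst_nonneg (hn i) hp hpq (hγ i)]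
  simp only [ofReal_prod_norm_rpow]
  refine ⟨fun f hf ↦ ?_, fun C hC ↦ ?_⟩
  · simp only [prodFracHardy_eq_lintegral β hf]
    exact KernelBound.pi hp0 hpq (fun i ↦ measurable_hardyKernel (hn i) (β i))
      (a := fun i x ↦ ENNReal.ofReal (‖x‖ ^ α i)) (fun i ↦ by fun_prop)
      (fun i x ↦ ENNReal.ofReal_ne_top) (g := fun i x ↦ ENNReal.ofReal (‖x‖ ^ γ i))
      (fun i ↦ by fun_prop)
      (fun i ↦ kernelBound_hardyKernel (hn i) hp hpq (hγ i) (hscal i)) f hf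
  · choose F hF h0 htop heq using
      fun i ↦ exists_hardyKernel_eq (hn i) hp hpq (hγ i) (hscal i)
    have hfm : Measurable fun x : ∀ i, EuclideanSpace ℝ (Fin (n i)) ↦ ∏ i, F i (x i) :=
      Finset.measurable_fun_prod _ fun i _ ↦ (hF i).comp (measurable_pi_apply i)
    have hKm (i) (x : EuclideanSpace ℝ (Fin (n i))) :
        Measurable fun y ↦ hardyKernel (n i) (β i) x y * F i y :=
      (measurable_hardyKernel (hn i) (β i)).of_uncurry_left.mul (hF i)
    have hR : ∫⁻ x : ∀ i, EuclideanSpace ℝ (Fin (n i)),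
        (∏ i, F i (x i)) ^ p * ∏ i, ENNReal.ofReal (‖x i‖ ^ γ i) =
        ∏ i, ∫⁻ x, F i x ^ p * ENNReal.ofReal (‖x‖ ^ γ i) := by
      have hm (i) : Measurable fun x ↦ F i x ^ p * ENNReal.ofReal (‖x‖ ^ γ i) :=
        ((hF i).pow_const p).mul (by fun_prop)
      rw [← lintegral_pi_prod hm]
      simp only [Finset.prod_mul_distrib, ENNReal.prod_rpow_of_nonneg hp0.le]
    have hL : ∫⁻ x, prodFracHardy m n β (fun x ↦ ∏ i, F i (x i)) x ^ q *
          ∏ i, ENNReal.ofReal (‖x i‖ ^ α i) =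
        ∏ i, ∫⁻ x, (∫⁻ y, hardyKernel (n i) (β i) x y * F i y) ^ q *
          ENNReal.ofReal (‖x‖ ^ α i) := by
      have hm (i) : Measurable fun x ↦ (∫⁻ y, hardyKernel (n i) (β i) x y * F i y) ^ q *
          ENNReal.ofReal (‖x‖ ^ α i) :=
        (((measurable_hardyKernel (hn i) (β i)).mul
          ((hF i).comp measurable_snd)).lintegral_prod_right'.pow_const q).mul (by fun_prop)
      rw [← lintegral_pi_prod hm]
      refine lintegral_congr fun x ↦ ?_
      rw [prodFracHardy_eq_lintegral β hfm]
      simp only [← Finset.prod_mul_distrib]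
      rw [lintegral_pi_prod fun i ↦ hKm i (x i), Finset.prod_mul_distrib,
        ENNReal.prod_rpow_of_nonneg hq.le]
    have h := hC _ hfm
    rw [hL, hR, ← ENNReal.prod_rpow_of_nonneg (by positivity),
      Finset.prod_congr rfl fun i _ ↦ heq i, Finset.prod_mul_distrib,
      ENNReal.prod_rpow_of_nonneg (by positivity)] at h
    have hne := Finset.prod_ne_zero_iff.2 fun i (_ : i ∈ Finset.univ) ↦ h0 i
    have hnt := ENNReal.prod_ne_top fun i (_ : i ∈ Finset.univ) ↦ htop i
    refine (ENNReal.mul_le_mul_iff_left ?_ ?_).1 h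
    · exact (ENNReal.rpow_pos (pos_iff_ne_zero.2 hne) hnt).ne'
    · exact ENNReal.rpow_ne_top_of_nonneg (by positivity) hnt
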